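/- arXiv:0806.4204 — 4 statements merged into one kernel-verified Lean document; each statement's English description precedes it below -/
import Mathlib

section
/- Let Ψ be an Orlicz function satisfying the Δ⁰ condition, (Ω,P) a probability space, X a closed linear subspace of the Morse–Transue space M^Ψ, Y a Banach space, and T : X → Y a bounded linear operator. Then the following are equivalent: (i) T is weakly compact; (ii) for some 1 ≤ p < ∞, for every ε > 0 there exists C_ε > 0 such that ‖Tf‖ ≤ C_ε ‖f‖_{L^p} + ε ‖f‖_Ψ for all f ∈ X; (iii) for every 1 ≤ p < ∞, for every ε > 0 there exists C_ε > 0 such that ‖Tf‖ ≤ C_ε ‖f‖_{L^p} + ε ‖f‖_Ψ for all f ∈ X. -/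
open MeasureTheory Filter Set Topology ENNReal NNReal

noncomputable section

/-- An Orlicz function: non-decreasing, convex (indeed strictly convex), vanishing and
continuous at `0`, with `Ψ x / x → ∞` as `x → ∞`. (We regard it as a function `ℝ → ℝ`,
only its values on `[0,∞)` being relevant.) -/
structure IsOrliczFunction (Ψ : ℝ → ℝ) : Prop where
  map_zero : Ψ 0 = 0
  nonneg : ∀ x, 0 ≤ Ψ x
  mono : MonotoneOn Ψ (Set.Ici (0 : ℝ))
  strictConvexOn : StrictConvexOn ℝ (Set.Ici (0 : ℝ)) Ψ
  continuousWithinAt_zero : ContinuousWithinAt Ψ (Set.Ici (0 : ℝ)) 0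
  tendsto_div_atTop : Tendsto (fun x => Ψ x / x) atTop atTop

/-- The Orlicz modular `∫ Ψ(|f|/C) dμ` (as an extended nonneg real). -/
def orliczModular {Ω : Type*} [MeasurableSpace Ω] (Ψ : ℝ → ℝ) (μ : Measure Ω)
    (f : Ω → ℂ) (C : ℝ) : ℝ≥0∞ :=
  ∫⁻ ω, ENNReal.ofReal (Ψ (‖f ω‖ / C)) ∂μ

/-- The Luxemburg norm. -/
def luxNorm {Ω : Type*} [MeasurableSpace Ω] (Ψ : ℝ → ℝ) (μ : Measure Ω) (f : Ω → ℂ) : ℝ :=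
  sInf {C : ℝ | 0 < C ∧ orliczModular Ψ μ f C ≤ 1}

/-- Membership in the Orlicz space `L^Ψ`. -/
def MemOrlicz {Ω : Type*} [MeasurableSpace Ω] (Ψ : ℝ → ℝ) (μ : Measure Ω) (f : Ω → ℂ) : Prop :=
  AEStronglyMeasurable f μ ∧ ∃ C > 0, orliczModular Ψ μ f C < ⊤

/-- Membership in the Morse–Transue space `M^Ψ` (the closure of `L^∞` in `L^Ψ`). -/
def MemMorseTransue {Ω : Type*} [MeasurableSpace Ω] (Ψ : ℝ → ℝ) (μ : Measure Ω)
    (f : Ω → ℂ) : Prop :=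
  AEStronglyMeasurable f μ ∧ ∀ C > 0, orliczModular Ψ μ f C < ⊤

/-- A subspace `X` is closed (in the Luxemburg norm) in the Morse–Transue space. -/
def IsLuxClosedIn {Ω : Type*} [MeasurableSpace Ω] (Ψ : ℝ → ℝ) (μ : Measure Ω)
    (X : Submodule ℂ (Ω → ℂ)) : Prop :=
  ∀ f : Ω → ℂ, MemMorseTransue Ψ μ f →
    (∀ ε > 0, ∃ g ∈ X, luxNorm Ψ μ (f - g) < ε) → f ∈ X

/-- A set in a normed space is relatively weakly compact. -/
def RelWeaklyCompact {Y : Type*} [NormedAddCommGroup Y] [NormedSpace ℂ Y] (S : Set Y) : Prop :=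
  ∃ K : Set (WeakSpace ℂ Y), IsCompact K ∧ (toWeakSpace ℂ Y) '' S ⊆ K

/-- The unit ball of a subspace `X` of `L^Ψ` for the Luxemburg norm. -/
def luxUnitBall {Ω : Type*} [MeasurableSpace Ω] (Ψ : ℝ → ℝ) (μ : Measure Ω)
    (X : Submodule ℂ (Ω → ℂ)) : Set X :=
  {f : X | luxNorm Ψ μ (f : Ω → ℂ) ≤ 1}

/-- An operator on a subspace of `L^Ψ` is weakly compact if the image of the unit ball is
relatively weakly compact. -/
def IsWeaklyCompactOp {Ω : Type*} [MeasurableSpace Ω] (Ψ : ℝ → ℝ) (μ : Measure Ω)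
    {X : Submodule ℂ (Ω → ℂ)} {Y : Type*} [NormedAddCommGroup Y] [NormedSpace ℂ Y]
    (T : X →ₗ[ℂ] Y) : Prop :=
  RelWeaklyCompact (⇑T '' luxUnitBall Ψ μ X)

/-- An operator on a subspace of `L^Ψ` is compact if the image of the unit ball is
relatively norm compact. -/
def IsCompactOp {Ω : Type*} [MeasurableSpace Ω] (Ψ : ℝ → ℝ) (μ : Measure Ω)
    {X : Submodule ℂ (Ω → ℂ)} {Y : Type*} [NormedAddCommGroup Y] [NormedSpace ℂ Y]
    (T : X →ₗ[ℂ] Y) : Prop :=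
  IsCompact (closure (⇑T '' luxUnitBall Ψ μ X))

/-- `T` fixes a copy of `c₀`: there is a sequence in `X`, equivalent to the canonical basis
of `c₀`, on whose (closed) span `T` is an isomorphism onto its image. -/
def FixesCopyOfC0 {Ω : Type*} [MeasurableSpace Ω] (Ψ : ℝ → ℝ) (μ : Measure Ω)
    {X : Submodule ℂ (Ω → ℂ)} {Y : Type*} [NormedAddCommGroup Y] [NormedSpace ℂ Y]
    (T : X →ₗ[ℂ] Y) : Prop :=
  ∃ (u : ℕ → X) (a b c : ℝ), 0 < a ∧ 0 < b ∧ 0 < c ∧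
    ∀ (co : ℕ → ℂ) (s : Finset ℕ),
      a * (⨆ k ∈ s, ‖co k‖) ≤ luxNorm Ψ μ ((∑ k ∈ s, co k • u k : X) : Ω → ℂ) ∧
      luxNorm Ψ μ ((∑ k ∈ s, co k • u k : X) : Ω → ℂ) ≤ b * (⨆ k ∈ s, ‖co k‖) ∧
      c * (⨆ k ∈ s, ‖co k‖) ≤ ‖T (∑ k ∈ s, co k • u k)‖

/-- The complementary (conjugate) Orlicz function `Φ(x) = sup_{y ≥ 0} (xy - Ψ(y))`. -/
def complementaryOrlicz (Ψ : ℝ → ℝ) (x : ℝ) : ℝ :=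
  sSup ((fun y => x * y - Ψ y) '' Set.Ici (0 : ℝ))

/-- The `Δ₂` condition. -/
def Delta2 (Φ : ℝ → ℝ) : Prop :=
  ∃ K > 0, ∃ x₀ > 0, ∀ x ≥ x₀, Φ (2 * x) ≤ K * Φ x

/-- The `Δ⁰` condition: for some `β > 1`, `Ψ(βx)/Ψ(x) → ∞` as `x → ∞`. -/
def Delta0 (Ψ : ℝ → ℝ) : Prop :=
  ∃ β > 1, Tendsto (fun x => Ψ (β * x) / Ψ x) atTop atTop

end

section WeakTopology

variable {Y : Type*} [NormedAddCommGroup Y] [NormedSpace ℂ Y]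

theorem le_nhds_weakSpace_iff {l : Filter (WeakSpace ℂ Y)} {y : WeakSpace ℂ Y} :
    l ≤ 𝓝 y ↔ ∀ φ : StrongDual ℂ Y, Tendsto (fun z => φ ((toWeakSpace ℂ Y).symm z)) l
      (𝓝 (φ ((toWeakSpace ℂ Y).symm y))) := by
  refine WeakBilin.tendsto_iff_forall_eval_tendsto (topDualPairing ℂ Y).flip
    (f := id) (fun a b hab => ?_)
  refine (SeparatingDual.eq_iff_forall_dual_eq (R := ℂ)).2 fun φ => ?_
  exact DFunLike.congr_fun hab φ

/-- A bounded ultrafilter in a Hilbert space has a weak limit, which lies in every closed convex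
set of the ultrafilter. -/
theorem exists_mem_closed_convex_of_ultrafilter {α H : Type*} [NormedAddCommGroup H]
    [InnerProductSpace ℂ H] [CompleteSpace H] (U : Ultrafilter α) (s : α → H) (R : ℝ)
    (hs : ∀ᶠ a in (U : Filter α), ‖s a‖ ≤ R) :
    ∃ h : H, ∀ C : Set H, IsClosed C → Convex ℝ C → (∀ᶠ a in (U : Filter α), s a ∈ C) → h ∈ C := by
  let J : H → WeakDual ℂ H := fun x => StrongDual.toWeakDual (InnerProductSpace.toDual ℂ H x)
  obtain ⟨ψ, -, hψ⟩ := isCompact_iff_ultrafilter_le_nhds.1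
    (WeakDual.isCompact_closedBall (𝕜 := ℂ) (0 : StrongDual ℂ H) R) (U.map (J ∘ s)) (by
      rw [le_principal_iff]
      change ∀ᶠ a in (U : Filter α), _
      filter_upwards [hs] with a ha
      change dist (InnerProductSpace.toDual ℂ H (s a)) 0 ≤ R
      simpa using ha)
  refine ⟨(InnerProductSpace.toDual ℂ H).symm (WeakDual.toStrongDual ψ), fun C hC hconv hmem => ?_⟩
  by_contra hh
  obtain ⟨f, u, hfu, hu⟩ := RCLike.geometric_hahn_banach_closed_point (𝕜 := ℂ) hconv hC hh
  set z := (InnerProductSpace.toDual ℂ H).symm f with hz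
  have hf : ∀ x, f x = inner ℂ z x := fun x => by simp [hz]
  have h1 : Tendsto (fun a => J (s a) z) (U : Filter α) (𝓝 (ψ z)) :=
    ((WeakDual.eval_continuous z).tendsto ψ).comp hψ
  have h2 : Tendsto (fun a => (J (s a) z).re) (U : Filter α) (𝓝 (ψ z).re) :=
    (Complex.continuous_re.tendsto _).comp h1
  have h3 : ∀ x, RCLike.re (f x) = (inner ℂ x z).re := fun x => by
    rw [hf, ← inner_conj_symm, RCLike.conj_re]; rfl
  have h4 : (ψ z).re ≤ u := by
    refine le_of_tendsto h2 ?_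
    filter_upwards [hmem] with a ha
    have := hfu _ ha
    rw [h3] at this
    exact this.le
  rw [h3] at hu
  have h5 : inner ℂ ((InnerProductSpace.toDual ℂ H).symm (WeakDual.toStrongDual ψ)) z = ψ z := by
    simp
  rw [h5] at hu
  exact absurd hu (not_lt.2 h4)

/-- A convex set of pairs whose first components are bounded in a Hilbert space and approximately
control the second components has a relatively weakly compact second projection. -/
theorem relWeaklyCompact_snd_image {H : Type*} [NormedAddCommGroup H] [InnerProductSpace ℂ H]
    [CompleteSpace H] [CompleteSpace Y] {Γ : Set (H × Y)} (hΓ : Convex ℝ Γ) {R : ℝ}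
    (hR : ∀ p ∈ Γ, ‖p.1‖ ≤ R)
    (hest : ∀ ε > 0, ∃ C > 0, ∀ p ∈ Γ, ∀ q ∈ Γ, ‖p.2 - q.2‖ ≤ C * ‖p.1 - q.1‖ + ε) :
    RelWeaklyCompact (Prod.snd '' Γ) := by
  set D := closure Γ with hD
  have hDR : ∀ p ∈ D, ‖p.1‖ ≤ R :=
    closure_minimal hR (isClosed_le continuous_fst.norm continuous_const)
  have hDest : ∀ ε > 0, ∃ C > 0, ∀ p ∈ D, ∀ q ∈ D, ‖p.2 - q.2‖ ≤ C * ‖p.1 - q.1‖ + ε := by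
    intro ε hε
    obtain ⟨C, hC, h⟩ := hest ε hε
    refine ⟨C, hC, fun p hp q hq => ?_⟩
    have hcl : closure (Γ ×ˢ Γ) ⊆
        {r : (H × Y) × (H × Y) | ‖r.1.2 - r.2.2‖ ≤ C * ‖r.1.1 - r.2.1‖ + ε} :=
      closure_minimal (fun r hr => h _ hr.1 _ hr.2) (isClosed_le (by fun_prop) (by fun_prop))
    rw [closure_prod_eq] at hcl
    exact hcl (Set.mk_mem_prod hp hq)
  have hproj : ∀ D' ⊆ D, IsClosed D' → IsClosed (Prod.fst '' D') := by
    intro D' hsub hD'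
    refine isClosed_of_closure_subset fun h hh => ?_
    obtain ⟨x, hx, hlim⟩ := mem_closure_iff_seq_limit.1 hh
    choose p hp hpx using hx
    have hlim' : Tendsto (fun n => (p n).1) atTop (𝓝 h) := by simpa only [hpx] using hlim
    have hc : CauchySeq (fun n => (p n).2) := by
      refine Metric.cauchySeq_iff.2 fun ε hε => ?_
      obtain ⟨C, hC, hCe⟩ := hDest (ε / 2) (half_pos hε)
      obtain ⟨N, hN⟩ := Metric.cauchySeq_iff.1 hlim'.cauchySeq (ε / 2 / C) (by positivity)
      refine ⟨N, fun m hm n hn => ?_⟩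
      have h1 := hN m hm n hn
      rw [dist_eq_norm, lt_div_iff₀ hC] at h1
      have h2 := hCe _ (hsub (hp m)) _ (hsub (hp n))
      rw [dist_eq_norm]
      linarith
    obtain ⟨y, hy⟩ := cauchySeq_tendsto_of_complete hc
    exact ⟨(h, y), hD'.mem_of_tendsto (hlim'.prodMk_nhds hy) (Eventually.of_forall hp), rfl⟩
  refine ⟨toWeakSpace ℂ Y '' (Prod.snd '' D), ?_, Set.image_mono (Set.image_mono subset_closure)⟩
  refine isCompact_iff_ultrafilter_le_nhds.2 fun F hF => ?_
  have hs : ∀ z : WeakSpace ℂ Y, ∃ p : H × Y, z ∈ toWeakSpace ℂ Y '' (Prod.snd '' D) →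
      p ∈ D ∧ p.2 = (toWeakSpace ℂ Y).symm z := by
    intro z
    by_cases hz : z ∈ toWeakSpace ℂ Y '' (Prod.snd '' D)
    · obtain ⟨-, ⟨p, hp, rfl⟩, rfl⟩ := hz
      exact ⟨p, fun _ => ⟨hp, by simp⟩⟩
    · exact ⟨0, fun h => absurd h hz⟩
  choose s hs using hs
  have hmem : ∀ᶠ z in (F : Filter (WeakSpace ℂ Y)),
      s z ∈ D ∧ (s z).2 = (toWeakSpace ℂ Y).symm z := by
    filter_upwards [le_principal_iff.1 hF] with z hz using hs z hz
  obtain ⟨h, hh⟩ := exists_mem_closed_convex_of_ultrafilter F (fun z => (s z).1) R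
    (hmem.mono fun z hz => hDR _ hz.1)
  have hfst : ∀ D' ⊆ D, IsClosed D' → Convex ℝ D' →
      (∀ᶠ z in (F : Filter (WeakSpace ℂ Y)), s z ∈ D') → ∃ y, (h, y) ∈ D' := by
    intro D' hsub hcl hconv hev
    obtain ⟨p, hp, hp'⟩ := hh (Prod.fst '' D') (hproj D' hsub hcl)
      (hconv.linear_image (LinearMap.fst ℝ H Y)) (hev.mono fun z hz => ⟨_, hz, rfl⟩)
    exact ⟨p.2, by rw [← hp']; exact hp⟩
  obtain ⟨y, hy⟩ := hfst D subset_rfl isClosed_closure hΓ.closure (hmem.mono fun z hz => hz.1)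
  have huniq : ∀ y', (h, y') ∈ D → y' = y := by
    intro y' hy'
    refine eq_of_sub_eq_zero (norm_le_zero_iff.1 (le_of_forall_pos_le_add fun ε hε => ?_))
    obtain ⟨C, -, hC⟩ := hDest ε hε
    simpa using hC _ hy' _ hy
  have hlt : ∀ φ : StrongDual ℂ Y, ∀ c, (φ y).re < c →
      ∀ᶠ z in (F : Filter (WeakSpace ℂ Y)), (φ ((toWeakSpace ℂ Y).symm z)).re < c := by
    intro φ c hc
    by_contra hcon
    rw [← Ultrafilter.eventually_not] at hcon
    obtain ⟨y', hy'D, hy'⟩ := hfst (D ∩ {p | c ≤ (φ p.2).re}) inter_subset_left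
      (isClosed_closure.inter (isClosed_le (by fun_prop) (by fun_prop)))
      (hΓ.closure.inter (by
        intro p hp q hq a b ha hb hab
        simp only [mem_ofPred_eq] at hp hq ⊢
        have h1 : (φ (a • p + b • q).2).re = a * (φ p.2).re + b * (φ q.2).re := by
          simp
        rw [h1]
        calc c = a * c + b * c := by rw [← add_mul, hab, one_mul]
          _ ≤ _ := by gcongr))
      (by
        filter_upwards [hcon, hmem] with z hz hz'
        exact ⟨hz'.1, by simpa [hz'.2] using hz⟩)
    rw [huniq y' hy'D] at hy'
    exact absurd hc (not_lt.2 hy')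
  have hre : ∀ φ : StrongDual ℂ Y, Tendsto (fun z => (φ ((toWeakSpace ℂ Y).symm z)).re)
      (F : Filter (WeakSpace ℂ Y)) (𝓝 (φ y).re) := by
    intro φ
    refine tendsto_order.2 ⟨fun c hc => ?_, hlt φ⟩
    filter_upwards [hlt (-φ) (-c) (by simpa using hc)] with z hz
    simpa using hz
  refine ⟨toWeakSpace ℂ Y y, ⟨y, ⟨_, hy, rfl⟩, rfl⟩, le_nhds_weakSpace_iff.2 fun φ => ?_⟩
  have him := hre (-Complex.I • φ)
  rw [LinearEquiv.symm_apply_apply]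
  have := ((Complex.continuous_ofReal.tendsto _).comp (hre φ)).add
    (((Complex.continuous_ofReal.tendsto _).comp him).mul_const Complex.I)
  simpa [Function.comp_def, Complex.re_add_im] using this

/-- A series with relatively weakly compact partial sums over all finite sets which is weakly
absolutely summable has terms converging to zero in norm. -/
theorem tendsto_zero_of_relWeaklyCompact_sums [CompleteSpace Y] {y : ℕ → Y} {S : Set Y}
    (hS : RelWeaklyCompact S) (hsum : ∀ s : Finset ℕ, ∑ j ∈ s, y j ∈ S)
    (hφ : ∀ φ : StrongDual ℂ Y, Summable fun j => ‖φ (y j)‖) :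
    Tendsto y atTop (𝓝 0) := by
  obtain ⟨K, hK, hSK⟩ := hS
  have hsumF : ∀ (F : ℕ → Bool) (φ : StrongDual ℂ Y),
      Summable fun j => φ (if F j then y j else 0) := fun F φ =>
    Summable.of_norm_bounded (hφ φ) fun j => by split_ifs <;> simp
  have hz : ∀ F : ℕ → Bool, ∃ z : Y, ∀ φ : StrongDual ℂ Y,
      φ z = ∑' j, φ (if F j then y j else 0) := by
    intro F
    let u : ℕ → WeakSpace ℂ Y := fun n =>
      toWeakSpace ℂ Y (∑ j ∈ Finset.range n, if F j then y j else 0)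
    have hu : ∀ n, u n ∈ K := fun n => hSK ⟨_, by
      rw [← Finset.sum_filter]; exact hsum _, rfl⟩
    obtain ⟨z, -, hz⟩ := isCompact_iff_ultrafilter_le_nhds.1 hK
      ((Ultrafilter.of atTop).map u) (by
        rw [le_principal_iff]
        exact Filter.mem_map.2 (Filter.univ_mem' hu))
    refine ⟨(toWeakSpace ℂ Y).symm z, fun φ => ?_⟩
    have h1 := le_nhds_weakSpace_iff.1 hz φ
    have h2 : Tendsto (fun n => φ ((toWeakSpace ℂ Y).symm (u n)))
      ((Ultrafilter.of atTop : Ultrafilter ℕ) : Filter ℕ) (𝓝 (φ ((toWeakSpace ℂ Y).symm z))) := h1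
    have h3 := ((hsumF F φ).hasSum.tendsto_sum_nat).mono_left (Ultrafilter.of_le atTop)
    refine tendsto_nhds_unique h2 (h3.congr fun n => ?_)
    simp [u, map_sum]
  choose z hz using hz
  have hcont : ∀ φ : StrongDual ℂ Y, Continuous fun F => φ (z F) := by
    intro φ
    simp_rw [hz]
    refine continuous_tsum (fun j => ?_) (hφ φ) fun j F => by split_ifs <;> simp
    exact (continuous_of_discreteTopology (f := fun b : Bool => φ (if b then y j else 0))).comp
      (continuous_apply j)
  set V := (Submodule.span ℂ (Set.range y)).topologicalClosure with hV
  have hzV : ∀ F, z F ∈ V := by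
    intro F
    by_contra hF
    obtain ⟨f, u, hfu, hu⟩ := RCLike.geometric_hahn_banach_closed_point (𝕜 := ℂ)
      (V.restrictScalars ℝ).convex (Submodule.isClosed_topologicalClosure _) hF
    have hf0 : ∀ x ∈ V, f x = 0 := by
      intro x hx
      by_contra hne
      have := hfu (((u : ℂ) / f x) • x) (V.smul_mem _ hx)
      simp [hne] at this
    have h0 : f (z F) = 0 := by
      rw [hz]
      refine (tsum_congr fun j => ?_).trans tsum_zero
      refine hf0 _ ?_
      split_ifs
      · exact Submodule.le_topologicalClosure _ (Submodule.subset_span ⟨j, rfl⟩)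
      · exact V.zero_mem
    have h1 := hfu 0 V.zero_mem
    rw [h0] at hu
    rw [map_zero] at h1
    exact lt_asymm h1 hu
  have hsep : TopologicalSpace.IsSeparable (V : Set Y) := by
    rw [hV, Submodule.topologicalClosure_coe]
    exact ((Set.countable_range y).isSeparable.span).closure
  obtain ⟨c, hc, hVc⟩ := hsep
  rw [tendsto_zero_iff_norm_tendsto_zero]
  refine Metric.tendsto_atTop.2 fun ε hε => ?_
  have hclosed : ∀ q : c, IsClosed {F | ‖z F - q‖ ≤ ε / 3} := by
    intro q
    have : {F | ‖z F - q‖ ≤ ε / 3} =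
        ⋂ φ : {φ : StrongDual ℂ Y // ‖φ‖ ≤ 1}, {F | ‖φ.1 (z F) - φ.1 q‖ ≤ ε / 3} := by
      ext F
      simp only [mem_ofPred_eq, mem_iInter]
      constructor
      · rintro h ⟨φ, hφ1⟩
        rw [← map_sub]
        exact (φ.le_of_opNorm_le hφ1 _).trans (by simpa using h)
      · intro h
        obtain ⟨g, hg, hgx⟩ := exists_dual_vector'' ℂ (z F - q)
        have := h ⟨g, hg⟩
        rw [← map_sub, hgx] at this
        simpa using this
    rw [this]
    refine isClosed_iInter fun φ => isClosed_le ?_ continuous_const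
    exact ((hcont φ.1).sub continuous_const).norm
  have hcover : ⋃ q : c, {F | ‖z F - q‖ ≤ ε / 3} = univ := by
    refine eq_univ_of_forall fun F => ?_
    obtain ⟨q, hq, hd⟩ := Metric.mem_closure_iff.1 (hVc (hzV F)) (ε / 3) (by positivity)
    rw [dist_eq_norm] at hd
    exact mem_iUnion.2 ⟨⟨q, hq⟩, hd.le⟩
  have := hc.to_subtype
  obtain ⟨q, F₀, hF₀⟩ := nonempty_interior_of_iUnion_of_closed hclosed hcover
  have hup : ∀ b, Tendsto (fun k => Function.update F₀ k b) atTop (𝓝 F₀) := by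
    intro b
    refine tendsto_pi_nhds.2 fun i => tendsto_const_nhds.congr' ?_
    filter_upwards [eventually_gt_atTop i] with k hk
    rw [Function.update_of_ne hk.ne]
  have hnhds : {F | ‖z F - q‖ ≤ ε / 3} ∈ 𝓝 F₀ := mem_interior_iff_mem_nhds.1 hF₀
  obtain ⟨N, hN⟩ := eventually_atTop.1
    (((hup true).eventually hnhds).and ((hup false).eventually hnhds))
  refine ⟨N, fun k hk => ?_⟩
  obtain ⟨h1, h2⟩ := hN k hk
  have hdiff : y k = z (Function.update F₀ k true) - z (Function.update F₀ k false) := by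
    refine (SeparatingDual.eq_iff_forall_dual_eq (R := ℂ)).2 fun φ => ?_
    rw [map_sub, hz, hz, ← (hsumF _ φ).tsum_sub (hsumF _ φ), tsum_eq_single k]
    · simp
    · intro j hj
      simp [Function.update_of_ne hj]
  rw [dist_zero_right, norm_norm, hdiff]
  calc ‖z (Function.update F₀ k true) - z (Function.update F₀ k false)‖
      = ‖(z (Function.update F₀ k true) - q) - (z (Function.update F₀ k false) - q)‖ := by
        congr 1; abel
    _ ≤ ε / 3 + ε / 3 := (norm_sub_le _ _).trans (add_le_add h1 h2)
    _ < ε := by linarith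

end WeakTopology

section Orlicz

variable {Ω : Type*} [MeasurableSpace Ω] {μ : Measure Ω} {Ψ : ℝ → ℝ}

namespace IsOrliczFunction

theorem continuousOn (hΨ : IsOrliczFunction Ψ) : ContinuousOn Ψ (Ici 0) := by
  intro x hx
  rcases (mem_Ici.1 hx).eq_or_lt with rfl | hx0
  · exact hΨ.continuousWithinAt_zero
  · have h := hΨ.strictConvexOn.convexOn.continuousOn_interior
    rw [interior_Ici] at h
    exact (h.continuousAt (Ioi_mem_nhds hx0)).continuousWithinAt

theorem continuous_ofReal_abs (hΨ : IsOrliczFunction Ψ) :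
    Continuous fun x : ℝ => ENNReal.ofReal (Ψ |x|) :=
  ENNReal.continuous_ofReal.comp
    (hΨ.continuousOn.comp_continuous continuous_abs fun x => abs_nonneg x)

theorem aemeasurable_comp (hΨ : IsOrliczFunction Ψ) {g : Ω → ℝ} (hg : AEMeasurable g μ)
    (hg0 : ∀ ω, 0 ≤ g ω) : AEMeasurable (fun ω => ENNReal.ofReal (Ψ (g ω))) μ := by
  have := hΨ.continuous_ofReal_abs.measurable.comp_aemeasurable hg
  simpa only [Function.comp_def, abs_of_nonneg (hg0 _)] using this

theorem tendsto_comp (hΨ : IsOrliczFunction Ψ) {u : ℕ → ℝ} {a : ℝ} (hu : Tendsto u atTop (𝓝 a))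
    (hu0 : ∀ n, 0 ≤ u n) :
    Tendsto (fun n => ENNReal.ofReal (Ψ (u n))) atTop (𝓝 (ENNReal.ofReal (Ψ a))) := by
  have ha : 0 ≤ a := ge_of_tendsto' hu hu0
  have := (hΨ.continuous_ofReal_abs.tendsto a).comp hu
  simpa only [Function.comp_def, abs_of_nonneg (hu0 _), abs_of_nonneg ha] using this

theorem le_of_le (hΨ : IsOrliczFunction Ψ) {x y : ℝ} (hx : 0 ≤ x) (hxy : x ≤ y) : Ψ x ≤ Ψ y :=
  hΨ.mono hx (hx.trans hxy) hxy

theorem pos (hΨ : IsOrliczFunction Ψ) {x : ℝ} (hx : 0 < x) : 0 < Ψ x := by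
  refine (hΨ.nonneg x).lt_of_ne fun h => ?_
  have h1 := hΨ.strictConvexOn.2 (mem_Ici.2 (le_refl (0 : ℝ))) (mem_Ici.2 hx.le) hx.ne
    (half_pos one_pos) (half_pos one_pos) (add_halves 1)
  rw [hΨ.map_zero, ← h] at h1
  simp only [smul_eq_mul, mul_zero, add_zero] at h1
  exact absurd h1 (not_lt.2 (hΨ.nonneg _))

theorem convex_comb (hΨ : IsOrliczFunction Ψ) {x y a b : ℝ} (hx : 0 ≤ x) (hy : 0 ≤ y)
    (ha : 0 ≤ a) (hb : 0 ≤ b) (hab : a + b = 1) : Ψ (a * x + b * y) ≤ a * Ψ x + b * Ψ y := by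
  simpa using hΨ.strictConvexOn.convexOn.2 (mem_Ici.2 hx) (mem_Ici.2 hy) ha hb hab

/-- An Orlicz function satisfying `Δ⁰` dominates every power. -/
theorem exists_rpow_le (hΨ : IsOrliczFunction Ψ) (hΔ : Delta0 Ψ) {p η : ℝ} (hη : 0 < η) :
    ∃ A, 1 ≤ A ∧ ∀ x ≥ A, x ^ p ≤ η * Ψ x := by
  obtain ⟨β, hβ, hlim⟩ := hΔ
  obtain ⟨k, hk⟩ := exists_nat_ge p
  obtain ⟨x₁, hx₁⟩ := eventually_atTop.1 (hlim.eventually_ge_atTop (β ^ (k + 1)))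
  set x₀ := max x₁ 1
  have hx₀ : 1 ≤ x₀ := le_max_right _ _
  have hx₀pos : 0 < x₀ := one_pos.trans_le hx₀
  have hβ0 : 0 < β := one_pos.trans hβ
  have hpow : ∀ n : ℕ, (β ^ n) ^ (k + 1) * Ψ x₀ ≤ Ψ (β ^ n * x₀) := by
    intro n
    induction n with
    | zero => simp
    | succ n ih =>
      have hge : x₀ ≤ β ^ n * x₀ := le_mul_of_one_le_left hx₀pos.le (one_le_pow₀ hβ.le)
      have h1 := hx₁ (β ^ n * x₀) ((le_max_left _ _).trans hge)
      rw [le_div_iff₀ (hΨ.pos (hx₀pos.trans_le hge))] at h1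
      calc (β ^ (n + 1)) ^ (k + 1) * Ψ x₀ = β ^ (k + 1) * ((β ^ n) ^ (k + 1) * Ψ x₀) := by ring
        _ ≤ β ^ (k + 1) * Ψ (β ^ n * x₀) := by gcongr
        _ ≤ Ψ (β * (β ^ n * x₀)) := h1
        _ = Ψ (β ^ (n + 1) * x₀) := by ring_nf
  set c := Ψ x₀ / (x₀ * β) ^ (k + 1)
  have hc : 0 < c := div_pos (hΨ.pos hx₀pos) (by positivity)
  have hlow : ∀ x ≥ x₀, c * x ^ (k + 1) ≤ Ψ x := by
    intro x hx
    have hx0 : 0 < x := hx₀pos.trans_le hx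
    obtain ⟨n, hn1, hn2⟩ := exists_nat_pow_near ((one_le_div hx₀pos).2 hx) hβ
    rw [le_div_iff₀ hx₀pos] at hn1
    rw [div_lt_iff₀ hx₀pos] at hn2
    have hle : x / (x₀ * β) ≤ β ^ n := by
      rw [div_le_iff₀ (by positivity)]
      calc x ≤ β ^ (n + 1) * x₀ := hn2.le
        _ = β ^ n * (x₀ * β) := by ring
    calc c * x ^ (k + 1) = (x / (x₀ * β)) ^ (k + 1) * Ψ x₀ := by
          simp only [c, div_pow]; ring
      _ ≤ (β ^ n) ^ (k + 1) * Ψ x₀ := by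
          have := hΨ.nonneg x₀
          gcongr
      _ ≤ Ψ (β ^ n * x₀) := hpow n
      _ ≤ Ψ x := hΨ.le_of_le (by positivity) hn1
  refine ⟨max x₀ (1 / (η * c)), hx₀.trans (le_max_left _ _), fun x hx => ?_⟩
  have hxx₀ : x₀ ≤ x := (le_max_left _ _).trans hx
  have hx1 : 1 ≤ x := hx₀.trans hxx₀
  have hx2 : 1 ≤ x * (η * c) := by
    rw [← div_le_iff₀ (by positivity)]; exact (le_max_right _ _).trans hx
  calc x ^ p ≤ x ^ (k : ℝ) := Real.rpow_le_rpow_of_exponent_le hx1 hk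
    _ = x ^ k * 1 := by rw [Real.rpow_natCast, mul_one]
    _ ≤ x ^ k * (x * (η * c)) := by gcongr
    _ = η * (c * x ^ (k + 1)) := by ring
    _ ≤ η * Ψ x := by gcongr; exact hlow x hxx₀

end IsOrliczFunction

theorem luxNorm_nonneg (f : Ω → ℂ) : 0 ≤ luxNorm Ψ μ f := Real.sInf_nonneg fun _ h => h.1.le

theorem luxNorm_le {f : Ω → ℂ} {C : ℝ} (hC : 0 < C) (h : orliczModular Ψ μ f C ≤ 1) :
    luxNorm Ψ μ f ≤ C :=
  csInf_le ⟨0, fun _ h => h.1.le⟩ ⟨hC, h⟩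

theorem orliczModular_le_one_of_convex_bound (hΨ : IsOrliczFunction Ψ) {f g h : Ω → ℂ}
    {C C' a b : ℝ} (hC : 0 < C) (hC' : 0 < C') (hf : AEStronglyMeasurable f μ)
    (ha : 0 ≤ a) (hb : 0 ≤ b) (hab : a + b = 1)
    (hh : ∀ ω, ‖h ω‖ / C' ≤ a * (‖f ω‖ / C) + b * (‖g ω‖ / C))
    (hf1 : orliczModular Ψ μ f C ≤ 1) (hg1 : orliczModular Ψ μ g C ≤ 1) :
    orliczModular Ψ μ h C' ≤ 1 := by
  have hmeas : AEMeasurable (fun ω => ENNReal.ofReal a * ENNReal.ofReal (Ψ (‖f ω‖ / C))) μ :=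
    (hΨ.aemeasurable_comp (hf.norm.aemeasurable.div_const C) fun ω => by positivity).const_mul _
  calc orliczModular Ψ μ h C'
      ≤ ∫⁻ ω, (ENNReal.ofReal a * ENNReal.ofReal (Ψ (‖f ω‖ / C))
          + ENNReal.ofReal b * ENNReal.ofReal (Ψ (‖g ω‖ / C))) ∂μ := by
        refine lintegral_mono fun ω => ?_
        rw [← ENNReal.ofReal_mul ha, ← ENNReal.ofReal_mul hb,
          ← ENNReal.ofReal_add (mul_nonneg ha (hΨ.nonneg _)) (mul_nonneg hb (hΨ.nonneg _))]
        exact ENNReal.ofReal_le_ofReal ((hΨ.le_of_le (by positivity) (hh ω)).trans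
          (hΨ.convex_comb (by positivity) (by positivity) ha hb hab))
    _ = ENNReal.ofReal a * orliczModular Ψ μ f C + ENNReal.ofReal b * orliczModular Ψ μ g C := by
        rw [lintegral_add_left' hmeas, lintegral_const_mul' _ _ ENNReal.ofReal_ne_top,
          lintegral_const_mul' _ _ ENNReal.ofReal_ne_top]
        rfl
    _ ≤ ENNReal.ofReal a * 1 + ENNReal.ofReal b * 1 := by gcongr
    _ = 1 := by rw [mul_one, mul_one, ← ENNReal.ofReal_add ha hb, hab, ENNReal.ofReal_one]

theorem orliczModular_le_one_of_luxNorm_lt (hΨ : IsOrliczFunction Ψ) {f : Ω → ℂ}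
    (hf : MemMorseTransue Ψ μ f) {C : ℝ} (hC : luxNorm Ψ μ f < C) :
    orliczModular Ψ μ f C ≤ 1 := by
  have hne : {C : ℝ | 0 < C ∧ orliczModular Ψ μ f C ≤ 1}.Nonempty := by
    have hfin := hf.2 1 one_pos
    set k := max 1 (orliczModular Ψ μ f 1).toReal
    have hk : 0 < k := one_pos.trans_le (le_max_left _ _)
    have hk1 : k⁻¹ ≤ 1 := inv_le_one_of_one_le₀ (le_max_left _ _)
    refine ⟨k, hk, ?_⟩
    calc orliczModular Ψ μ f k
        ≤ ∫⁻ ω, ENNReal.ofReal k⁻¹ * ENNReal.ofReal (Ψ (‖f ω‖ / 1)) ∂μ := by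
          refine lintegral_mono fun ω => ?_
          rw [← ENNReal.ofReal_mul (by positivity)]
          refine ENNReal.ofReal_le_ofReal ?_
          have := hΨ.convex_comb (norm_nonneg (f ω)) le_rfl (inv_nonneg.2 hk.le)
            (sub_nonneg.2 hk1) (add_sub_cancel _ _)
          rw [hΨ.map_zero, mul_zero, add_zero, add_zero] at this
          rwa [div_one, div_eq_inv_mul]
      _ = ENNReal.ofReal k⁻¹ * orliczModular Ψ μ f 1 :=
          lintegral_const_mul' _ _ ENNReal.ofReal_ne_top
      _ = ENNReal.ofReal (k⁻¹ * (orliczModular Ψ μ f 1).toReal) := by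
          rw [ENNReal.ofReal_mul (by positivity), ENNReal.ofReal_toReal hfin.ne]
      _ ≤ 1 := by
          rw [ENNReal.ofReal_le_one, inv_mul_le_one₀ hk]
          exact le_max_right _ _
  obtain ⟨C', ⟨hC'0, hC'1⟩, hlt⟩ := exists_lt_of_csInf_lt hne hC
  refine le_trans (lintegral_mono fun ω => ENNReal.ofReal_le_ofReal ?_) hC'1
  exact hΨ.le_of_le (by have := hC'0.trans hlt; positivity) (by gcongr)

/-- The unit ball for the Luxemburg norm is convex. -/
theorem luxNorm_convex_comb_le_one (hΨ : IsOrliczFunction Ψ) {f g : Ω → ℂ}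
    (hf : MemMorseTransue Ψ μ f) (hg : MemMorseTransue Ψ μ g) (hf1 : luxNorm Ψ μ f ≤ 1)
    (hg1 : luxNorm Ψ μ g ≤ 1) {a b : ℝ} (ha : 0 ≤ a) (hb : 0 ≤ b) (hab : a + b = 1) :
    luxNorm Ψ μ ((a : ℂ) • f + (b : ℂ) • g) ≤ 1 := by
  refine le_of_forall_gt_imp_ge_of_dense fun C hC => ?_
  have hC0 : 0 < C := one_pos.trans hC
  refine luxNorm_le hC0 (orliczModular_le_one_of_convex_bound hΨ hC0 hC0 hf.1 ha hb hab
    (fun ω => ?_) (orliczModular_le_one_of_luxNorm_lt hΨ hf (hf1.trans_lt hC))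
    (orliczModular_le_one_of_luxNorm_lt hΨ hg (hg1.trans_lt hC)))
  rw [← mul_div_assoc, ← mul_div_assoc, ← add_div]
  gcongr
  refine (norm_add_le _ _).trans_eq ?_
  simp [abs_of_nonneg ha, abs_of_nonneg hb]

theorem luxNorm_sub_le_four (hΨ : IsOrliczFunction Ψ) {f g : Ω → ℂ}
    (hf : MemMorseTransue Ψ μ f) (hg : MemMorseTransue Ψ μ g) (hf1 : luxNorm Ψ μ f ≤ 1)
    (hg1 : luxNorm Ψ μ g ≤ 1) : luxNorm Ψ μ (f - g) ≤ 4 := by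
  refine luxNorm_le four_pos (orliczModular_le_one_of_convex_bound hΨ two_pos four_pos hf.1
    (a := 1 / 2) (b := 1 / 2) (by norm_num) (by norm_num) (by norm_num) (fun ω => ?_)
    (orliczModular_le_one_of_luxNorm_lt hΨ hf (hf1.trans_lt one_lt_two))
    (orliczModular_le_one_of_luxNorm_lt hΨ hg (hg1.trans_lt one_lt_two)))
  have := norm_sub_le (f ω) (g ω)
  rw [Pi.sub_apply]
  linarith

theorem orliczModular_smul {f : Ω → ℂ} {c C : ℝ} (hc : 0 < c) :
    orliczModular Ψ μ ((c : ℂ) • f) C = orliczModular Ψ μ f (c⁻¹ * C) := by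
  refine lintegral_congr fun ω => ?_
  rw [Pi.smul_apply, norm_smul, Complex.norm_real, Real.norm_of_nonneg hc.le]
  congr 2
  field_simp

/-- The `L^1` norm is bounded on the set of functions with modular at most one. -/
theorem exists_eLpNorm_one_le [IsProbabilityMeasure μ] (hΨ : IsOrliczFunction Ψ)
    (hΔ : Delta0 Ψ) : ∃ A > 0, ∀ f : Ω → ℂ, orliczModular Ψ μ f 1 ≤ 1 →
      eLpNorm f 1 μ ≤ ENNReal.ofReal A := by
  obtain ⟨A, hA, hA'⟩ := hΨ.exists_rpow_le hΔ (p := 1) one_pos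
  have hA0 : 0 ≤ A := zero_le_one.trans hA
  refine ⟨A + 1, by positivity, fun f hmod => ?_⟩
  replace hmod : ∫⁻ ω, ENNReal.ofReal (Ψ ‖f ω‖) ∂μ ≤ 1 := by
    simpa [orliczModular] using hmod
  calc eLpNorm f 1 μ = ∫⁻ ω, ‖f ω‖ₑ ∂μ := eLpNorm_one_eq_lintegral_enorm
    _ ≤ ∫⁻ ω, (ENNReal.ofReal A + ENNReal.ofReal (Ψ ‖f ω‖)) ∂μ := by
        refine lintegral_mono fun ω => ?_
        rw [← ofReal_norm, ← ENNReal.ofReal_add hA0 (hΨ.nonneg _)]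
        refine ENNReal.ofReal_le_ofReal ?_
        rcases le_total A ‖f ω‖ with h | h
        · have := hA' _ h
          rw [Real.rpow_one] at this
          linarith
        · linarith [hΨ.nonneg ‖f ω‖]
    _ ≤ ENNReal.ofReal A + 1 := by
        rw [lintegral_add_left measurable_const, lintegral_const, measure_univ, mul_one]
        gcongr
    _ = ENNReal.ofReal (A + 1) := by
        rw [ENNReal.ofReal_add hA0 zero_le_one, ENNReal.ofReal_one]

theorem eLpNorm_le_of_orliczModular_le_one [IsProbabilityMeasure μ] (hΨ : IsOrliczFunction Ψ)
    (hΔ : Delta0 Ψ) {p ε : ℝ} (hp : 1 ≤ p) (hε : 0 < ε) :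
    ∃ C > 0, ∀ f : Ω → ℂ, AEStronglyMeasurable f μ → orliczModular Ψ μ f 1 ≤ 1 →
      eLpNorm f (ENNReal.ofReal p) μ ≠ ⊤ ∧
      (eLpNorm f (ENNReal.ofReal p) μ).toReal ≤ C * (eLpNorm f 1 μ).toReal + ε := by
  have hp0 : 0 < p := one_pos.trans_le hp
  have hεp : 0 < ε ^ p := Real.rpow_pos_of_pos hε p
  obtain ⟨A₁, -, hL1⟩ := exists_eLpNorm_one_le (μ := μ) hΨ hΔ
  obtain ⟨A, hA, hA'⟩ := hΨ.exists_rpow_le hΔ (p := p) hεp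
  set D := A ^ (p - 1)
  have hD : 0 < D := Real.rpow_pos_of_pos (one_pos.trans_le hA) _
  have hpt : ∀ x, 0 ≤ x → x ^ p ≤ D * x + ε ^ p * Ψ x := by
    intro x hx
    rcases le_total A x with h | h
    · exact (hA' x h).trans (le_add_of_nonneg_left (by positivity))
    · refine le_trans ?_ (le_add_of_nonneg_right (mul_nonneg hεp.le (hΨ.nonneg x)))
      rcases hx.eq_or_lt with rfl | hx0
      · simp [Real.zero_rpow hp0.ne']
      · calc x ^ p = x ^ (p - 1) * x := by
              rw [← Real.rpow_add_one hx0.ne']; simp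
          _ ≤ D * x := by
              have := Real.rpow_le_rpow hx h (sub_nonneg.2 hp)
              gcongr
  refine ⟨ε * D / ε ^ p, by positivity, fun f hf hmod => ?_⟩
  have hmod' : ∫⁻ ω, ENNReal.ofReal (Ψ ‖f ω‖) ∂μ ≤ 1 := by
    simpa [orliczModular] using hmod
  have h1 : eLpNorm f 1 μ ≠ ⊤ := ne_top_of_le_ne_top ENNReal.ofReal_ne_top (hL1 f hmod)
  have hI : ∫⁻ ω, ‖f ω‖ₑ ^ p ∂μ ≤ ENNReal.ofReal (D * (eLpNorm f 1 μ).toReal + ε ^ p) := by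
    calc ∫⁻ ω, ‖f ω‖ₑ ^ p ∂μ
        ≤ ∫⁻ ω, (ENNReal.ofReal D * ‖f ω‖ₑ
            + ENNReal.ofReal (ε ^ p) * ENNReal.ofReal (Ψ ‖f ω‖)) ∂μ := by
          refine lintegral_mono fun ω => ?_
          have := hΨ.nonneg ‖f ω‖
          rw [← ofReal_norm, ENNReal.ofReal_rpow_of_nonneg (norm_nonneg _) hp0.le,
            ← ENNReal.ofReal_mul hD.le, ← ENNReal.ofReal_mul hεp.le,
            ← ENNReal.ofReal_add (by positivity) (by positivity)]
          exact ENNReal.ofReal_le_ofReal (hpt _ (norm_nonneg _))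
      _ = ENNReal.ofReal D * eLpNorm f 1 μ
            + ENNReal.ofReal (ε ^ p) * ∫⁻ ω, ENNReal.ofReal (Ψ ‖f ω‖) ∂μ := by
          rw [lintegral_add_left' (hf.enorm.const_mul _),
            lintegral_const_mul' _ _ ENNReal.ofReal_ne_top,
            lintegral_const_mul' _ _ ENNReal.ofReal_ne_top, eLpNorm_one_eq_lintegral_enorm]
      _ ≤ ENNReal.ofReal D * eLpNorm f 1 μ + ENNReal.ofReal (ε ^ p) * 1 := by gcongr
      _ = _ := by
          rw [mul_one, ENNReal.ofReal_add (by positivity) hεp.le, ENNReal.ofReal_mul hD.le,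
            ENNReal.ofReal_toReal h1]
  have hIfin : ∫⁻ ω, ‖f ω‖ₑ ^ p ∂μ ≠ ⊤ := ne_top_of_le_ne_top ENNReal.ofReal_ne_top hI
  have heq : eLpNorm f (ENNReal.ofReal p) μ = (∫⁻ ω, ‖f ω‖ₑ ^ p ∂μ) ^ (1 / p) := by
    rw [eLpNorm_eq_lintegral_rpow_enorm_toReal (by simpa using hp0) ENNReal.ofReal_ne_top,
      ENNReal.toReal_ofReal hp0.le]
  refine ⟨by rw [heq]; exact ENNReal.rpow_ne_top_of_nonneg (by positivity) hIfin, ?_⟩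
  set a := (eLpNorm f (ENNReal.ofReal p) μ).toReal with ha
  set N := (eLpNorm f 1 μ).toReal
  have hN : 0 ≤ N := ENNReal.toReal_nonneg
  have ha0 : 0 ≤ a := ENNReal.toReal_nonneg
  have hap : a ^ p ≤ D * N + ε ^ p := by
    rw [ha, heq, ENNReal.toReal_rpow, ← ENNReal.rpow_mul, one_div_mul_cancel hp0.ne',
      ENNReal.rpow_one]
    exact ENNReal.toReal_le_of_le_ofReal (by positivity) hI
  set w := D * N / ε ^ p
  have hw : 0 ≤ w := by positivity
  have h2 : (a / ε) ^ p ≤ 1 + w := by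
    rw [Real.div_rpow ha0 hε.le, div_le_iff₀ hεp]
    refine hap.trans_eq ?_
    simp only [w]
    field_simp
    ring
  have h3 : a / ε ≤ 1 + w := by
    by_contra! hcon
    have h4 : 1 ≤ a / ε := by linarith
    have h5 : (a / ε) ^ (1 : ℝ) ≤ (a / ε) ^ p := Real.rpow_le_rpow_of_exponent_le h4 hp
    rw [Real.rpow_one] at h5
    linarith
  rw [div_le_iff₀ hε] at h3
  refine h3.trans_eq ?_
  simp only [w]
  ring

/-- Under `Δ⁰`, the `L^p` norm on `M^Ψ` is finite and controlled by a large multiple of the `L^1`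
norm plus a small multiple of the Luxemburg norm. -/
theorem MemMorseTransue.eLpNorm_le [IsProbabilityMeasure μ] (hΨ : IsOrliczFunction Ψ)
    (hΔ : Delta0 Ψ) {p ε : ℝ} (hp : 1 ≤ p) (hε : 0 < ε) :
    ∃ C > 0, ∀ f : Ω → ℂ, MemMorseTransue Ψ μ f →
      eLpNorm f (ENNReal.ofReal p) μ ≠ ⊤ ∧
      (eLpNorm f (ENNReal.ofReal p) μ).toReal ≤
        C * (eLpNorm f 1 μ).toReal + ε * luxNorm Ψ μ f := by
  obtain ⟨C, hC, h⟩ := eLpNorm_le_of_orliczModular_le_one (μ := μ) hΨ hΔ hp hε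
  refine ⟨C, hC, fun f hf => ?_⟩
  have key : ∀ L > luxNorm Ψ μ f, eLpNorm f (ENNReal.ofReal p) μ ≠ ⊤ ∧
      (eLpNorm f (ENNReal.ofReal p) μ).toReal ≤ C * (eLpNorm f 1 μ).toReal + ε * L := by
    intro L hL
    have hL0 : 0 < L := (luxNorm_nonneg f).trans_lt hL
    have hsc : ∀ q, eLpNorm (((L⁻¹ : ℝ) : ℂ) • f) q μ = ENNReal.ofReal L⁻¹ * eLpNorm f q μ := by
      intro q
      rw [eLpNorm_const_smul, ← ofReal_norm, Complex.norm_real,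
        Real.norm_of_nonneg (by positivity)]
    obtain ⟨h2, h3⟩ := h (((L⁻¹ : ℝ) : ℂ) • f) (hf.1.const_smul _) (by
      rw [orliczModular_smul (by positivity), inv_inv, mul_one]
      exact orliczModular_le_one_of_luxNorm_lt hΨ hf hL)
    rw [hsc] at h2 h3
    rw [hsc, ENNReal.toReal_mul, ENNReal.toReal_mul, ENNReal.toReal_ofReal (by positivity)] at h3
    refine ⟨fun htop => h2 ?_, ?_⟩
    · rw [htop, ENNReal.mul_top]
      simpa using hL0
    · have := mul_le_mul_of_nonneg_left h3 hL0.le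
      field_simp at this
      linarith
  refine ⟨(key _ (lt_add_one _)).1, ?_⟩
  refine le_of_forall_pos_le_add fun δ hδ => ?_
  have := (key (luxNorm Ψ μ f + δ / ε) (lt_add_of_pos_right _ (by positivity))).2
  rw [mul_add, mul_div_cancel₀ _ hε.ne'] at this
  linarith

/-- Under `Δ⁰`, the unit ball of `M^Ψ` is bounded in `L^p`. -/
theorem exists_eLpNorm_le_of_luxNorm_le_one [IsProbabilityMeasure μ] (hΨ : IsOrliczFunction Ψ)
    (hΔ : Delta0 Ψ) {p : ℝ} (hp : 1 ≤ p) :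
    ∃ R, ∀ f : Ω → ℂ, MemMorseTransue Ψ μ f → luxNorm Ψ μ f ≤ 1 →
      (eLpNorm f (ENNReal.ofReal p) μ).toReal ≤ R := by
  obtain ⟨A, hA, hL1⟩ := exists_eLpNorm_one_le (μ := μ) hΨ hΔ
  obtain ⟨C, hC, hCp⟩ := MemMorseTransue.eLpNorm_le (μ := μ) hΨ hΔ hp one_pos
  refine ⟨C * (2 * A) + 1 * 1, fun f hf hf1 => (hCp f hf).2.trans ?_⟩
  have h := hL1 (((2⁻¹ : ℝ) : ℂ) • f) (by
    rw [orliczModular_smul (by norm_num)]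
    exact orliczModular_le_one_of_luxNorm_lt hΨ hf (hf1.trans_lt (by norm_num)))
  rw [eLpNorm_const_smul, ← ofReal_norm, Complex.norm_real] at h
  have h' := ENNReal.toReal_le_of_le_ofReal hA.le h
  rw [ENNReal.toReal_mul, ENNReal.toReal_ofReal (norm_nonneg _), Real.norm_of_nonneg (by norm_num)]
    at h'
  gcongr
  linarith

end Orlicz

section DeltaZero

variable {Ω : Type*} [MeasurableSpace Ω] {μ : Measure Ω} {Ψ : ℝ → ℝ}

theorem lintegral_orlicz_add_lt_top (hΨ : IsOrliczFunction Ψ) {u v : Ω → ℝ}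
    (hu : AEMeasurable u μ) (hu0 : ∀ ω, 0 ≤ u ω) (hv0 : ∀ ω, 0 ≤ v ω)
    (hu1 : ∀ C > 0, ∫⁻ ω, ENNReal.ofReal (Ψ (u ω / C)) ∂μ < ⊤)
    (hv1 : ∀ C > 0, ∫⁻ ω, ENNReal.ofReal (Ψ (v ω / C)) ∂μ < ⊤) {C : ℝ} (hC : 0 < C) :
    ∫⁻ ω, ENNReal.ofReal (Ψ ((u ω + v ω) / C)) ∂μ < ⊤ := by
  have h2 : 0 < C / 2 := half_pos hC
  have hnn : ∀ ω, 0 ≤ u ω / (C / 2) := fun ω => div_nonneg (hu0 ω) h2.le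
  have hnn' : ∀ ω, 0 ≤ v ω / (C / 2) := fun ω => div_nonneg (hv0 ω) h2.le
  calc ∫⁻ ω, ENNReal.ofReal (Ψ ((u ω + v ω) / C)) ∂μ
      ≤ ∫⁻ ω, (ENNReal.ofReal (Ψ (u ω / (C / 2))) + ENNReal.ofReal (Ψ (v ω / (C / 2)))) ∂μ := by
        refine lintegral_mono fun ω => ?_
        rw [← ENNReal.ofReal_add (hΨ.nonneg _) (hΨ.nonneg _)]
        refine ENNReal.ofReal_le_ofReal ?_
        have := hΨ.convex_comb (a := 1 / 2) (b := 1 / 2) (hnn ω) (hnn' ω) (by norm_num)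
          (by norm_num) (by norm_num)
        have heq : 1 / 2 * (u ω / (C / 2)) + 1 / 2 * (v ω / (C / 2)) = (u ω + v ω) / C := by
          field_simp
        rw [heq] at this
        linarith [hΨ.nonneg (u ω / (C / 2)), hΨ.nonneg (v ω / (C / 2))]
    _ < ⊤ := by
        rw [lintegral_add_left' (hΨ.aemeasurable_comp (hu.div_const _) hnn)]
        exact ENNReal.add_lt_top.2 ⟨hu1 _ h2, hv1 _ h2⟩

/-- Under `Δ⁰`, a sequence bounded in modular and tending to zero almost everywhere tends to zero
in modular after division by `β`. -/
theorem tendsto_lintegral_orlicz_div [IsProbabilityMeasure μ] (hΨ : IsOrliczFunction Ψ) {β : ℝ}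
    (hβ : 1 < β) (hlim : Tendsto (fun x => Ψ (β * x) / Ψ x) atTop atTop) {g : ℕ → Ω → ℝ}
    (hg : ∀ n, AEMeasurable (g n) μ) (hg0 : ∀ n ω, 0 ≤ g n ω)
    (hg1 : ∀ n, ∫⁻ ω, ENNReal.ofReal (Ψ (g n ω)) ∂μ ≤ 1)
    (hgae : ∀ᵐ ω ∂μ, Tendsto (fun n => g n ω) atTop (𝓝 0)) :
    Tendsto (fun n => ∫⁻ ω, ENNReal.ofReal (Ψ (g n ω / β)) ∂μ) atTop (𝓝 0) := by
  have hβ0 : 0 < β := one_pos.trans hβ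
  have hmeas : ∀ n, AEMeasurable (fun ω => ENNReal.ofReal (Ψ (g n ω / β))) μ := fun n =>
    hΨ.aemeasurable_comp ((hg n).div_const β) fun ω => div_nonneg (hg0 n ω) hβ0.le
  refine ENNReal.tendsto_nhds_zero.2 fun ε hε => ?_
  obtain ⟨η, hη, hηε⟩ : ∃ η : ℝ, 0 < η ∧ ENNReal.ofReal η ≤ ε / 2 := by
    obtain ⟨r, hr0, hr⟩ := ENNReal.lt_iff_exists_nnreal_btwn.1 (ENNReal.half_pos hε.ne')
    exact ⟨r, by simpa using hr0, by simpa using hr.le⟩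
  obtain ⟨t₁, ht₁⟩ := eventually_atTop.1 (hlim.eventually_ge_atTop (1 / η))
  set t := max t₁ 1
  have htpos : 0 < t := one_pos.trans_le (le_max_right _ _)
  have ht : ∀ x, t ≤ x → Ψ x ≤ η * Ψ (β * x) := by
    intro x hx
    have := ht₁ x ((le_max_left _ _).trans hx)
    rw [le_div_iff₀ (hΨ.pos (htpos.trans_le hx)), one_div, inv_mul_le_iff₀ hη] at this
    exact this
  set F : ℕ → Ω → ℝ≥0∞ := fun n ω => min (ENNReal.ofReal (Ψ (g n ω / β))) (ENNReal.ofReal (Ψ t))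
  have hF : Tendsto (fun n => ∫⁻ ω, F n ω ∂μ) atTop (𝓝 0) := by
    have := tendsto_lintegral_of_dominated_convergence' (μ := μ) (F := F) (f := fun _ => 0)
      (fun _ => ENNReal.ofReal (Ψ t)) (fun n => (hmeas n).min aemeasurable_const)
      (fun n => Eventually.of_forall fun ω => min_le_right _ _) (by simp) (by
        filter_upwards [hgae] with ω hω
        have h1 : Tendsto (fun n => g n ω / β) atTop (𝓝 0) := by simpa using hω.div_const β
        have h2 := hΨ.tendsto_comp h1 fun n => div_nonneg (hg0 n ω) hβ0.le
        rw [hΨ.map_zero, ENNReal.ofReal_zero] at h2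
        exact tendsto_of_tendsto_of_tendsto_of_le_of_le tendsto_const_nhds h2
          (fun n => zero_le) fun n => min_le_left _ _)
    simpa using this
  filter_upwards [ENNReal.tendsto_nhds_zero.1 hF (ε / 2) (ENNReal.half_pos hε.ne')] with n hn
  calc ∫⁻ ω, ENNReal.ofReal (Ψ (g n ω / β)) ∂μ
      ≤ ∫⁻ ω, (ENNReal.ofReal η * ENNReal.ofReal (Ψ (g n ω)) + F n ω) ∂μ := by
        refine lintegral_mono fun ω => ?_
        rcases le_total t (g n ω / β) with h | h
        · refine le_add_right ?_
          rw [← ENNReal.ofReal_mul hη.le]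
          refine ENNReal.ofReal_le_ofReal ((ht _ h).trans_eq ?_)
          rw [mul_div_cancel₀ _ hβ0.ne']
        · refine le_add_left (le_min le_rfl (ENNReal.ofReal_le_ofReal ?_))
          exact hΨ.le_of_le (div_nonneg (hg0 n ω) hβ0.le) h
    _ = ENNReal.ofReal η * ∫⁻ ω, ENNReal.ofReal (Ψ (g n ω)) ∂μ + ∫⁻ ω, F n ω ∂μ := by
        rw [lintegral_add_left' ((hΨ.aemeasurable_comp (hg n) (hg0 n)).const_mul _),
          lintegral_const_mul' _ _ ENNReal.ofReal_ne_top]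
    _ ≤ ε / 2 * 1 + ε / 2 := by gcongr; exact hg1 n
    _ = ε := by rw [mul_one, ENNReal.add_halves]

theorem exists_lintegral_orlicz_add_le [IsProbabilityMeasure μ] (hΨ : IsOrliczFunction Ψ) {β : ℝ}
    (hβ : 1 < β) (hlim : Tendsto (fun x => Ψ (β * x) / Ψ x) atTop atTop) {g : ℕ → Ω → ℝ}
    (hg : ∀ n, AEMeasurable (g n) μ) (hg0 : ∀ n ω, 0 ≤ g n ω)
    (hg1 : ∀ n, ∫⁻ ω, ENNReal.ofReal (Ψ (g n ω)) ∂μ ≤ 1)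
    (hgae : ∀ᵐ ω ∂μ, Tendsto (fun n => g n ω) atTop (𝓝 0)) {S : Ω → ℝ} (hS : AEMeasurable S μ)
    (hS0 : ∀ ω, 0 ≤ S ω) (hS1 : ∫⁻ ω, ENNReal.ofReal (Ψ (S ω / β)) ∂μ < ⊤) {δ : ℝ≥0∞}
    (hδ : δ ≠ 0) :
    ∃ n, ∫⁻ ω, ENNReal.ofReal (Ψ ((S ω + g n ω) / (2 * β))) ∂μ ≤
      ∫⁻ ω, ENNReal.ofReal (Ψ (S ω / (2 * β))) ∂μ + δ := by
  have hβ0 : 0 < β := one_pos.trans hβ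
  have h2β : 0 < 2 * β := by positivity
  have hG := tendsto_lintegral_orlicz_div hΨ hβ hlim hg hg0 hg1 hgae
  have hsum0 : ∀ n ω, 0 ≤ (S ω + g n ω) / (2 * β) := fun n ω =>
    div_nonneg (add_nonneg (hS0 ω) (hg0 n ω)) h2β.le
  have hle : ∀ ω, Ψ (S ω / (2 * β)) ≤ Ψ (S ω / β) := fun ω =>
    hΨ.le_of_le (div_nonneg (hS0 ω) h2β.le)
      (div_le_div_of_nonneg_left (hS0 ω) hβ0 (by linarith))
  set F : ℕ → Ω → ℝ≥0∞ := fun n ω =>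
    min (ENNReal.ofReal (Ψ ((S ω + g n ω) / (2 * β)))) (ENNReal.ofReal (Ψ (S ω / β)))
  have hFmeas : ∀ n, AEMeasurable (F n) μ := fun n =>
    (hΨ.aemeasurable_comp ((hS.add (hg n)).div_const _) (hsum0 n)).min
      (hΨ.aemeasurable_comp (hS.div_const β) fun ω => div_nonneg (hS0 ω) hβ0.le)
  have hF : Tendsto (fun n => ∫⁻ ω, F n ω ∂μ) atTop
      (𝓝 (∫⁻ ω, ENNReal.ofReal (Ψ (S ω / (2 * β))) ∂μ)) := by
    refine tendsto_lintegral_of_dominated_convergence'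
      (fun ω => ENNReal.ofReal (Ψ (S ω / β))) hFmeas
      (fun n => Eventually.of_forall fun ω => min_le_right _ _) hS1.ne ?_
    filter_upwards [hgae] with ω hω
    have h1 : Tendsto (fun n => (S ω + g n ω) / (2 * β)) atTop (𝓝 (S ω / (2 * β))) := by
      simpa using (hω.const_add (S ω)).div_const (2 * β)
    have h2 := (hΨ.tendsto_comp h1 fun n => hsum0 n ω).min
      (tendsto_const_nhds (x := ENNReal.ofReal (Ψ (S ω / β))))
    rwa [min_eq_left (ENNReal.ofReal_le_ofReal (hle ω))] at h2
  have hfin : ∫⁻ ω, ENNReal.ofReal (Ψ (S ω / (2 * β))) ∂μ ≠ ⊤ :=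
    ne_top_of_le_ne_top hS1.ne (lintegral_mono fun ω => ENNReal.ofReal_le_ofReal (hle ω))
  have hlt := ENNReal.lt_add_right hfin hδ
  have hsum := hF.add hG
  rw [add_zero] at hsum
  obtain ⟨n, hn⟩ := (hsum.eventually_lt_const hlt).exists
  refine ⟨n, le_trans ?_ hn.le⟩
  rw [← lintegral_add_left' (hFmeas n)]
  refine lintegral_mono fun ω => ?_
  rcases le_total (S ω) (g n ω) with h | h
  · refine le_add_left (ENNReal.ofReal_le_ofReal (hΨ.le_of_le (hsum0 n ω) ?_))
    rw [div_le_div_iff₀ h2β hβ0]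
    nlinarith
  · refine le_add_right (le_min le_rfl (ENNReal.ofReal_le_ofReal (hΨ.le_of_le (hsum0 n ω) ?_)))
    rw [div_le_div_iff₀ h2β hβ0]
    nlinarith

/-- Under `Δ⁰`, a sequence in `M^Ψ` bounded in modular and tending to zero almost everywhere has
a selection whose absolute partial sums are bounded in `L^Ψ`. -/
theorem exists_selection_sum_bounded [IsProbabilityMeasure μ] (hΨ : IsOrliczFunction Ψ) {β : ℝ}
    (hβ : 1 < β) (hlim : Tendsto (fun x => Ψ (β * x) / Ψ x) atTop atTop) {f : ℕ → Ω → ℂ}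
    (hf : ∀ n, MemMorseTransue Ψ μ (f n)) (hf1 : ∀ n, orliczModular Ψ μ (f n) 1 ≤ 1)
    (hfae : ∀ᵐ ω ∂μ, Tendsto (fun n => f n ω) atTop (𝓝 0)) :
    ∃ m : ℕ → ℕ, ∀ k, ∫⁻ ω, ENNReal.ofReal
      (Ψ ((∑ j ∈ Finset.range k, ‖f (m j) ω‖) / (2 * β))) ∂μ ≤ 1 := by
  have hβ0 : 0 < β := one_pos.trans hβ
  have hgm : ∀ n, AEMeasurable (fun ω => ‖f n ω‖) μ := fun n => (hf n).1.norm.aemeasurable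
  let P : (Ω → ℝ) → Prop := fun S => AEMeasurable S μ ∧ (∀ ω, 0 ≤ S ω) ∧
    ∀ C > 0, ∫⁻ ω, ENNReal.ofReal (Ψ (S ω / C)) ∂μ < ⊤
  have hstep : ∀ (k : ℕ) (S : Ω → ℝ), ∃ n, P S →
      ∫⁻ ω, ENNReal.ofReal (Ψ ((S ω + ‖f n ω‖) / (2 * β))) ∂μ ≤
      ∫⁻ ω, ENNReal.ofReal (Ψ (S ω / (2 * β))) ∂μ + 2⁻¹ ^ (k + 1) := by
    intro k S
    by_cases hS : P S
    · obtain ⟨n, hn⟩ := exists_lintegral_orlicz_add_le hΨ hβ hlim hgm (fun n ω => norm_nonneg _)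
        (fun n => by simpa [orliczModular] using hf1 n)
        (hfae.mono fun ω hω => by simpa using hω.norm) hS.1 hS.2.1 (hS.2.2 β hβ0)
        (δ := 2⁻¹ ^ (k + 1)) (by simp)
      exact ⟨n, fun _ => hn⟩
    · exact ⟨0, fun h => absurd h hS⟩
  choose n hn using hstep
  let S : ℕ → Ω → ℝ := fun k => Nat.rec (fun _ => 0) (fun k S ω => S ω + ‖f (n k S) ω‖) k
  have hS_succ : ∀ k ω, S (k + 1) ω = S k ω + ‖f (n k (S k)) ω‖ := fun k ω => rfl
  have hP : ∀ k, P (S k) := by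
    intro k
    induction k with
    | zero => exact ⟨aemeasurable_const, fun _ => le_rfl, fun C _ => by simp [S, hΨ.map_zero]⟩
    | succ k ih =>
      refine ⟨ih.1.add (hgm _), fun ω => add_nonneg (ih.2.1 ω) (norm_nonneg _), fun C hC => ?_⟩
      exact lintegral_orlicz_add_lt_top hΨ ih.1 ih.2.1 (fun ω => norm_nonneg _) ih.2.2
        (hf _).2 hC
  have hsum : ∀ k ω, S k ω = ∑ j ∈ Finset.range k, ‖f (n j (S j)) ω‖ := by
    intro k ω
    induction k with
    | zero => rfl
    | succ k ih => rw [Finset.sum_range_succ, ← ih, hS_succ]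
  have hbound : ∀ k, ∫⁻ ω, ENNReal.ofReal (Ψ (S k ω / (2 * β))) ∂μ + 2⁻¹ ^ k ≤ 1 := by
    intro k
    induction k with
    | zero => simp [S, hΨ.map_zero]
    | succ k ih =>
      refine le_trans ?_ ih
      have h2 : (2⁻¹ : ℝ≥0∞) ^ (k + 1) + 2⁻¹ ^ (k + 1) = 2⁻¹ ^ k := by
        rw [pow_succ, ← mul_add, ENNReal.inv_two_add_inv_two, mul_one]
      rw [← h2, ← add_assoc]
      gcongr
      exact hn k (S k) (hP k)
  refine ⟨fun j => n j (S j), fun k => ?_⟩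
  simp_rw [← hsum]
  exact le_self_add.trans (hbound k)

end DeltaZero

section Estimates

variable {Ω : Type*} [MeasurableSpace Ω] {μ : Measure Ω} {Ψ : ℝ → ℝ}
  {X : Submodule ℂ (Ω → ℂ)} {Y : Type*} [NormedAddCommGroup Y] [NormedSpace ℂ Y]
  {T : X →ₗ[ℂ] Y}

/-- The unit ball of a subspace of `M^Ψ` is convex. -/
theorem convex_luxUnitBall (hΨ : IsOrliczFunction Ψ) (hXM : ∀ f ∈ X, MemMorseTransue Ψ μ f) :
    Convex ℝ (luxUnitBall Ψ μ X) := fun f hf g hg _ _ ha hb hab =>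
  luxNorm_convex_comb_le_one hΨ (hXM f f.2) (hXM g g.2) hf hg ha hb hab

variable [IsProbabilityMeasure μ]

/-- An operator controlled by a large multiple of the `L^2` norm plus a small multiple of the
Luxemburg norm is weakly compact. -/
theorem isWeaklyCompactOp_of_estimate [CompleteSpace Y] (hΨ : IsOrliczFunction Ψ)
    (hΔ : Delta0 Ψ) (hXM : ∀ f ∈ X, MemMorseTransue Ψ μ f)
    (h : ∀ ε > 0, ∃ C > 0, ∀ f : X, ‖T f‖ ≤ C * (eLpNorm (f : Ω → ℂ) 2 μ).toReal
      + ε * luxNorm Ψ μ (f : Ω → ℂ)) :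
    IsWeaklyCompactOp Ψ μ T := by
  have h2 : ENNReal.ofReal 2 = 2 := by simp
  have hmem : ∀ f : X, MemLp (f : Ω → ℂ) 2 μ := fun f => by
    obtain ⟨C, -, hC⟩ := MemMorseTransue.eLpNorm_le (μ := μ) hΨ hΔ one_le_two one_pos
    exact ⟨(hXM f f.2).1, h2 ▸ (hC f (hXM f f.2)).1.lt_top⟩
  let J : X →ₗ[ℂ] Lp ℂ 2 μ :=
    { toFun := fun f => (hmem f).toLp _
      map_add' := fun f g => MemLp.toLp_add (hmem f) (hmem g)
      map_smul' := fun c f => MemLp.toLp_const_smul c (hmem f) }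
  have hJ : ∀ f, ‖J f‖ = (eLpNorm (f : Ω → ℂ) 2 μ).toReal := fun f => Lp.norm_toLp _ (hmem f)
  obtain ⟨R, hR⟩ := exists_eLpNorm_le_of_luxNorm_le_one (μ := μ) hΨ hΔ one_le_two
  rw [h2] at hR
  have key := relWeaklyCompact_snd_image (Γ := J.prod T '' luxUnitBall Ψ μ X)
    ((convex_luxUnitBall hΨ hXM).linear_image ((J.prod T).restrictScalars ℝ)) (R := R)
    (by
      rintro - ⟨f, hf, rfl⟩
      exact (hJ f).trans_le (hR f (hXM f f.2) hf))
    (by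
      intro ε hε
      obtain ⟨C, hC, hCT⟩ := h (ε / 4) (by positivity)
      refine ⟨C, hC, ?_⟩
      rintro - ⟨f, hf, rfl⟩ - ⟨g, hg, rfl⟩
      have h1 := hCT (f - g)
      have h4 : luxNorm Ψ μ ((f - g : X) : Ω → ℂ) ≤ 4 :=
        luxNorm_sub_le_four hΨ (hXM f f.2) (hXM g g.2) hf hg
      rw [← hJ, map_sub, map_sub] at h1
      calc ‖T f - T g‖ ≤ C * ‖J f - J g‖ + ε / 4 * luxNorm Ψ μ ((f - g : X) : Ω → ℂ) := h1
        _ ≤ C * ‖J f - J g‖ + ε / 4 * 4 := by gcongr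
        _ = C * ‖J f - J g‖ + ε := by ring)
  rwa [Set.image_image] at key

/-- An estimate in terms of some `L^p` norm yields one in terms of any `L^q` norm. -/
theorem estimate_of_estimate (hΨ : IsOrliczFunction Ψ) (hΔ : Delta0 Ψ)
    (hXM : ∀ f ∈ X, MemMorseTransue Ψ μ f) {p q : ℝ} (hp : 1 ≤ p) (hq : 1 ≤ q)
    (h : ∀ ε > 0, ∃ C > 0, ∀ f : X, ‖T f‖ ≤
      C * (eLpNorm (f : Ω → ℂ) (ENNReal.ofReal p) μ).toReal + ε * luxNorm Ψ μ (f : Ω → ℂ)) :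
    ∀ ε > 0, ∃ C > 0, ∀ f : X, ‖T f‖ ≤
      C * (eLpNorm (f : Ω → ℂ) (ENNReal.ofReal q) μ).toReal + ε * luxNorm Ψ μ (f : Ω → ℂ) := by
  intro ε hε
  obtain ⟨C, hC, hCT⟩ := h (ε / 2) (half_pos hε)
  obtain ⟨D, hD, hDp⟩ := MemMorseTransue.eLpNorm_le (μ := μ) hΨ hΔ hp (ε := ε / (2 * C))
    (by positivity)
  obtain ⟨E, -, hEq⟩ := MemMorseTransue.eLpNorm_le (μ := μ) hΨ hΔ hq one_pos
  refine ⟨C * D, by positivity, fun f => (hCT f).trans ?_⟩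
  have hf := hXM f f.2
  have h1 : (eLpNorm (f : Ω → ℂ) 1 μ).toReal ≤
      (eLpNorm (f : Ω → ℂ) (ENNReal.ofReal q) μ).toReal :=
    ENNReal.toReal_mono (hEq f hf).1
      (eLpNorm_le_eLpNorm_of_exponent_le (by simpa using hq) hf.1)
  calc C * (eLpNorm (f : Ω → ℂ) (ENNReal.ofReal p) μ).toReal + ε / 2 * luxNorm Ψ μ (f : Ω → ℂ)
      ≤ C * (D * (eLpNorm (f : Ω → ℂ) (ENNReal.ofReal q) μ).toReal
          + ε / (2 * C) * luxNorm Ψ μ (f : Ω → ℂ)) + ε / 2 * luxNorm Ψ μ (f : Ω → ℂ) := by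
        gcongr
        exact (hDp f hf).2.trans (by gcongr)
    _ = _ := by field_simp; ring

/-- A weakly compact operator sends a sequence bounded in modular and tending to zero almost
everywhere to one with terms of arbitrarily small norm. -/
theorem IsWeaklyCompactOp.exists_norm_lt [CompleteSpace Y] (hT : IsWeaklyCompactOp Ψ μ T)
    (hΨ : IsOrliczFunction Ψ) (hΔ : Delta0 Ψ) (hXM : ∀ f ∈ X, MemMorseTransue Ψ μ f)
    {M : ℝ} (hM : ∀ f : X, ‖T f‖ ≤ M * luxNorm Ψ μ (f : Ω → ℂ)) {g : ℕ → X}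
    (hg1 : ∀ n, orliczModular Ψ μ (g n) 1 ≤ 1)
    (hgae : ∀ᵐ ω ∂μ, Tendsto (fun n => (g n : Ω → ℂ) ω) atTop (𝓝 0)) {δ : ℝ} (hδ : 0 < δ) :
    ∃ n, ‖T (g n)‖ < δ := by
  obtain ⟨β, hβ, hlim⟩ := hΔ
  obtain ⟨m, hm⟩ := exists_selection_sum_bounded hΨ hβ hlim (fun n => hXM _ (g n).2) hg1 hgae
  have hb : 0 < 2 * β := by linarith
  set b : ℂ := (((2 * β)⁻¹ : ℝ) : ℂ)
  have hbnorm : ‖b‖ = (2 * β)⁻¹ := by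
    rw [Complex.norm_real, Real.norm_of_nonneg (by positivity)]
  have hball : ∀ (s : Finset ℕ) (c : ℕ → ℂ), (∀ j, ‖c j‖ ≤ 1) →
      luxNorm Ψ μ ((∑ j ∈ s, c j • b • g (m j) : X) : Ω → ℂ) ≤ 1 := by
    intro s c hc
    obtain ⟨N, hN⟩ := s.exists_nat_subset_range
    refine luxNorm_le one_pos (le_trans (lintegral_mono fun ω => ?_) (hm N))
    refine ENNReal.ofReal_le_ofReal (hΨ.le_of_le (by positivity) ?_)
    rw [div_one, Submodule.coe_sum, Finset.sum_apply, div_eq_inv_mul, Finset.mul_sum]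
    calc ‖∑ j ∈ s, ((c j • b • g (m j) : X) : Ω → ℂ) ω‖
        ≤ ∑ j ∈ s, (2 * β)⁻¹ * ‖(g (m j) : Ω → ℂ) ω‖ := by
          refine norm_sum_le_of_le _ fun j _ => ?_
          simp only [Submodule.coe_smul, Pi.smul_apply, norm_smul, hbnorm]
          exact mul_le_of_le_one_left (by positivity) (hc j)
      _ ≤ _ := Finset.sum_le_sum_of_subset_of_nonneg hN fun j _ _ => by positivity
  have hlimT := tendsto_zero_of_relWeaklyCompact_sums (y := fun j => T (b • g (m j))) hT
    (fun s => ⟨∑ j ∈ s, b • g (m j), by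
      have := hball s (fun _ => 1) (by simp)
      simp only [one_smul] at this
      exact this, map_sum _ _ _⟩)
    (fun φ => by
      choose c hc hc' using fun j => RCLike.exists_norm_eq_mul_self (φ (T (b • g (m j))))
      refine summable_of_sum_le (c := ‖φ‖ * |M|) (fun j => norm_nonneg _) fun s => ?_
      have hs : ((∑ j ∈ s, ‖φ (T (b • g (m j)))‖ : ℝ) : ℂ) =
          φ (T (∑ j ∈ s, c j • b • g (m j))) := by
        push_cast
        rw [map_sum, map_sum]
        refine Finset.sum_congr rfl fun j _ => ?_
        rw [T.map_smul (c j), φ.map_smul, smul_eq_mul]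
        exact hc' j
      calc ∑ j ∈ s, ‖φ (T (b • g (m j)))‖
          = ‖φ (T (∑ j ∈ s, c j • b • g (m j)))‖ := by
            rw [← hs, Complex.norm_real, Real.norm_of_nonneg (by positivity)]
        _ ≤ ‖φ‖ * ‖T (∑ j ∈ s, c j • b • g (m j))‖ := φ.le_opNorm _
        _ ≤ ‖φ‖ * |M| := by
            gcongr
            refine (hM _).trans ((mul_le_mul_of_nonneg_right (le_abs_self M)
              (luxNorm_nonneg _)).trans ?_)
            exact mul_le_of_le_one_right (abs_nonneg M) (hball s c fun j => (hc j).le))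
  obtain ⟨j, hj⟩ := (hlimT.norm.eventually_lt_const
    (show ‖(0 : Y)‖ < (2 * β)⁻¹ * δ by rw [norm_zero]; positivity)).exists
  rw [LinearMap.map_smul, norm_smul, hbnorm] at hj
  exact ⟨m j, lt_of_mul_lt_mul_left hj (by positivity)⟩

/-- A weakly compact operator is controlled by a large multiple of the `L^1` norm plus a small
multiple of the Luxemburg norm. -/
theorem IsWeaklyCompactOp.estimate [CompleteSpace Y] (hT : IsWeaklyCompactOp Ψ μ T)
    (hΨ : IsOrliczFunction Ψ) (hΔ : Delta0 Ψ) (hXM : ∀ f ∈ X, MemMorseTransue Ψ μ f)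
    {M : ℝ} (hM : ∀ f : X, ‖T f‖ ≤ M * luxNorm Ψ μ (f : Ω → ℂ)) {ε : ℝ} (hε : 0 < ε) :
    ∃ C > 0, ∀ f : X, ‖T f‖ ≤ C * (eLpNorm (f : Ω → ℂ) 1 μ).toReal
      + ε * luxNorm Ψ μ (f : Ω → ℂ) := by
  by_contra! hcon
  choose f hf using fun n : ℕ => hcon (n + 1) (by positivity)
  set L := fun n => luxNorm Ψ μ (f n : Ω → ℂ)
  have hL : ∀ n, 0 < L n := by
    intro n
    refine (luxNorm_nonneg _).lt_of_ne' fun h0 => ?_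
    have h1 := hM (f n)
    have h2 := hf n
    rw [h0, mul_zero] at h1 h2
    have : 0 ≤ ((n : ℝ) + 1) * (eLpNorm (f n : Ω → ℂ) 1 μ).toReal := by positivity
    linarith
  set g : ℕ → X := fun n => (((2 * L n)⁻¹ : ℝ) : ℂ) • f n
  have hc : ∀ n, 0 < (2 * L n)⁻¹ := fun n => by have := hL n; positivity
  have hg1 : ∀ n, orliczModular Ψ μ (g n) 1 ≤ 1 := fun n => by
    rw [Submodule.coe_smul, orliczModular_smul (hc n), inv_inv, mul_one]
    exact orliczModular_le_one_of_luxNorm_lt hΨ (hXM _ (f n).2) (by linarith [hL n])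
  have hTg : ∀ n, ε / 2 ≤ ‖T (g n)‖ := fun n => by
    rw [LinearMap.map_smul, norm_smul, Complex.norm_real, Real.norm_of_nonneg (hc n).le,
      ← div_eq_inv_mul, le_div_iff₀ (by linarith [hL n])]
    have : 0 ≤ ((n : ℝ) + 1) * (eLpNorm (f n : Ω → ℂ) 1 μ).toReal := by positivity
    linarith [hf n]
  obtain ⟨A, hA, hL1⟩ := exists_eLpNorm_one_le (μ := μ) hΨ hΔ
  have hgn : ∀ n, eLpNorm (g n : Ω → ℂ) 1 μ ≤ ENNReal.ofReal (M / 2 * (1 / ((n : ℝ) + 1))) := by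
    intro n
    rw [← ENNReal.ofReal_toReal (ne_top_of_le_ne_top ENNReal.ofReal_ne_top (hL1 _ (hg1 n)))]
    refine ENNReal.ofReal_le_ofReal ?_
    rw [Submodule.coe_smul, eLpNorm_const_smul, ← ofReal_norm, Complex.norm_real,
      Real.norm_of_nonneg (hc n).le, ENNReal.toReal_mul, ENNReal.toReal_ofReal (hc n).le,
      inv_mul_le_iff₀ (by linarith [hL n]), mul_one_div, mul_div_assoc',
      le_div_iff₀ (by positivity)]
    have := (hf n).trans_le (hM _)
    have := mul_pos hε (hL n)
    linarith
  have hg0 : Tendsto (fun n => eLpNorm ((g n : Ω → ℂ) - 0) 1 μ) atTop (𝓝 0) := by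
    have h0 : Tendsto (fun n : ℕ => ENNReal.ofReal (M / 2 * (1 / ((n : ℝ) + 1)))) atTop (𝓝 0) := by
      simpa using ENNReal.tendsto_ofReal
        ((tendsto_one_div_add_atTop_nhds_zero_nat (𝕜 := ℝ)).const_mul (M / 2))
    simpa only [sub_zero] using tendsto_of_tendsto_of_tendsto_of_le_of_le tendsto_const_nhds h0
      (fun n => zero_le) hgn
  obtain ⟨ns, -, hns⟩ := (tendstoInMeasure_of_tendsto_eLpNorm one_ne_zero
    (fun n => (hXM _ (g n).2).1) aestronglyMeasurable_zero hg0).exists_seq_tendsto_ae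
  obtain ⟨n, hn⟩ := hT.exists_norm_lt hΨ hΔ hXM hM (g := g ∘ ns) (fun n => hg1 _) hns
    (half_pos hε)
  exact absurd hn (not_lt.2 (hTg _))

end Estimates

noncomputable section

/-- If `Ψ ∈ Δ⁰`, an operator `T` on a subspace `X` of `M^Ψ` is weakly compact iff, for some
(equivalently, for all) `1 ≤ p < ∞`: for every `ε > 0` there is `C_ε > 0` with
`‖Tf‖ ≤ C_ε ‖f‖_p + ε ‖f‖_Ψ` for all `f ∈ X`. -/
theorem statement2 {Ω : Type*} [MeasurableSpace Ω] (μ : Measure Ω) [IsProbabilityMeasure μ]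
    {Ψ : ℝ → ℝ} (hΨ : IsOrliczFunction Ψ) (hΔ : Delta0 Ψ)
    (X : Submodule ℂ (Ω → ℂ)) (hXM : ∀ f ∈ X, MemMorseTransue Ψ μ f)
    (hXclosed : IsLuxClosedIn Ψ μ X)
    {Y : Type*} [NormedAddCommGroup Y] [NormedSpace ℂ Y] [CompleteSpace Y]
    (T : X →ₗ[ℂ] Y) (hT : ∃ M : ℝ, ∀ f : X, ‖T f‖ ≤ M * luxNorm Ψ μ (f : Ω → ℂ)) :
    (IsWeaklyCompactOp Ψ μ T ↔
      ∃ p : ℝ, 1 ≤ p ∧ ∀ ε > 0, ∃ C > 0, ∀ f : X,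
        ‖T f‖ ≤ C * (eLpNorm (f : Ω → ℂ) (ENNReal.ofReal p) μ).toReal
            + ε * luxNorm Ψ μ (f : Ω → ℂ)) ∧
    (IsWeaklyCompactOp Ψ μ T ↔
      ∀ p : ℝ, 1 ≤ p → ∀ ε > 0, ∃ C > 0, ∀ f : X,
        ‖T f‖ ≤ C * (eLpNorm (f : Ω → ℂ) (ENNReal.ofReal p) μ).toReal
            + ε * luxNorm Ψ μ (f : Ω → ℂ)) := by
  obtain ⟨M, hM⟩ := hT
  have hall : IsWeaklyCompactOp Ψ μ T → ∀ p : ℝ, 1 ≤ p → ∀ ε > 0, ∃ C > 0, ∀ f : X,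
      ‖T f‖ ≤ C * (eLpNorm (f : Ω → ℂ) (ENNReal.ofReal p) μ).toReal
        + ε * luxNorm Ψ μ (f : Ω → ℂ) := fun hwc p hp =>
    estimate_of_estimate hΨ hΔ hXM le_rfl hp fun ε hε => by
      simpa using hwc.estimate hΨ hΔ hXM hM hε
  have hsome : (∃ p : ℝ, 1 ≤ p ∧ ∀ ε > 0, ∃ C > 0, ∀ f : X,
      ‖T f‖ ≤ C * (eLpNorm (f : Ω → ℂ) (ENNReal.ofReal p) μ).toReal
        + ε * luxNorm Ψ μ (f : Ω → ℂ)) → IsWeaklyCompactOp Ψ μ T := fun ⟨p, hp, h⟩ =>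
    isWeaklyCompactOp_of_estimate hΨ hΔ hXM
      (by simpa using estimate_of_estimate hΨ hΔ hXM hp one_le_two h)
  exact ⟨⟨fun h => ⟨1, le_rfl, hall h 1 le_rfl⟩, hsome⟩,
    ⟨hall, fun h => hsome ⟨1, le_rfl, h 1 le_rfl⟩⟩⟩

end
end

section
/- Let T : X → Y be a bounded linear operator between Banach spaces. Assume there is a Banach space Z and a weakly compact operator j : X → Z such that: for every ε > 0 there exists C_ε > 0 with ‖Tx‖ ≤ C_ε ‖jx‖_Z + ε ‖x‖_X for all x ∈ X. Then T is weakly compact. -/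
open MeasureTheory Filter Set Topology ENNReal NNReal

noncomputable section

/-- If `j` converges weakly to `z` along a filter, then every convex member of the filter contains
points whose images under `j` are arbitrarily close to `z` in norm. -/
theorem Convex.neBot_comap_nhds_inf_principal {𝕜 X Z : Type*} [RCLike 𝕜]
    [AddCommGroup X] [Module 𝕜 X] [Module ℝ X] [IsScalarTower ℝ 𝕜 X]
    [NormedAddCommGroup Z] [NormedSpace 𝕜 Z] [NormedSpace ℝ Z] [IsScalarTower ℝ 𝕜 Z]
    (j : X →ₗ[𝕜] Z) {A : Set X} (hA : Convex ℝ A) {l : Filter X} [l.NeBot] (hAl : A ∈ l) {z : Z}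
    (hz : Tendsto (fun x => toWeakSpace 𝕜 Z (j x)) l (𝓝 (toWeakSpace 𝕜 Z z))) :
    (comap j (𝓝 z) ⊓ 𝓟 A).NeBot := by
  have hconv : Convex ℝ (j '' A) := hA.linear_image (j.restrictScalars ℝ)
  have hmem : toWeakSpace 𝕜 Z z ∈ closure (toWeakSpace 𝕜 Z '' (j '' A)) :=
    mem_closure_of_tendsto hz <| by
      filter_upwards [hAl] with x hx using mem_image_of_mem _ (mem_image_of_mem _ hx)
  rw [← hconv.toWeakSpace_closure 𝕜] at hmem
  obtain ⟨w, hw, hwz⟩ := hmem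
  obtain rfl := (toWeakSpace 𝕜 Z).injective hwz
  rw [mem_closure_iff_clusterPt, ClusterPt, ← map_principal, ← Filter.push_pull',
    map_neBot_iff] at hw
  exact hw

/-- Under an interpolation inequality `‖T x‖ ≤ C_ε ‖j x‖ + ε ‖x‖`, norm convergence of `j` along
a filter supported in the unit ball forces norm convergence of `T`. -/
theorem exists_tendsto_of_norm_le_add {𝕜 X Y Z : Type*} [NontriviallyNormedField 𝕜]
    [NormedAddCommGroup X] [NormedSpace 𝕜 X]
    [NormedAddCommGroup Y] [NormedSpace 𝕜 Y] [CompleteSpace Y]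
    [NormedAddCommGroup Z] [NormedSpace 𝕜 Z]
    (T : X →ₗ[𝕜] Y) (j : X →ₗ[𝕜] Z)
    (h : ∀ ε > 0, ∃ C > 0, ∀ x : X, ‖T x‖ ≤ C * ‖j x‖ + ε * ‖x‖)
    {l : Filter X} [l.NeBot] (hl : Metric.closedBall 0 1 ∈ l) {z : Z}
    (hz : Tendsto j l (𝓝 z)) : ∃ y, Tendsto T l (𝓝 y) := by
  rw [← cauchy_map_iff_exists_tendsto, Metric.cauchy_iff]
  refine ⟨inferInstance, fun ε hε => ?_⟩
  obtain ⟨C, hC, hTC⟩ := h (ε / 4) (by positivity)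
  have hδ : 0 < ε / (4 * C) := by positivity
  refine ⟨_, image_mem_map (inter_mem hl (hz (Metric.ball_mem_nhds z hδ))), ?_⟩
  rintro _ ⟨a, ⟨ha, haz⟩, rfl⟩ _ ⟨b, ⟨hb, hbz⟩, rfl⟩
  have hj : ‖j (a - b)‖ < 2 * (ε / (4 * C)) := by
    rw [map_sub, ← dist_eq_norm]
    have := dist_triangle_right (j a) (j b) z
    rw [mem_preimage, Metric.mem_ball] at haz hbz
    linarith
  have hab : ‖a - b‖ ≤ 2 := by
    rw [mem_closedBall_zero_iff] at ha hb
    linarith [norm_sub_le a b]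
  rw [dist_eq_norm, ← map_sub]
  calc ‖T (a - b)‖ ≤ C * ‖j (a - b)‖ + ε / 4 * ‖a - b‖ := hTC _
    _ < C * (2 * (ε / (4 * C))) + ε / 4 * 2 :=
        add_lt_add_of_lt_of_le (mul_lt_mul_of_pos_left hj hC) (by gcongr)
    _ = ε := by field_simp; norm_num

/-- If `T : X → Y` is an operator between Banach spaces and there are a Banach space `Z` and
a weakly compact operator `j : X → Z` such that for every `ε > 0` there is `C_ε > 0` with
`‖Tx‖ ≤ C_ε ‖jx‖ + ε ‖x‖` for all `x`, then `T` is weakly compact. -/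
theorem statement5 {X Y Z : Type*} [NormedAddCommGroup X] [NormedSpace ℂ X] [CompleteSpace X]
    [NormedAddCommGroup Y] [NormedSpace ℂ Y] [CompleteSpace Y]
    [NormedAddCommGroup Z] [NormedSpace ℂ Z] [CompleteSpace Z]
    (T : X →L[ℂ] Y) (j : X →L[ℂ] Z)
    (hj : RelWeaklyCompact (⇑j '' Metric.closedBall 0 1))
    (h : ∀ ε > 0, ∃ C > 0, ∀ x : X, ‖T x‖ ≤ C * ‖j x‖ + ε * ‖x‖) :
    RelWeaklyCompact (⇑T '' Metric.closedBall 0 1) := by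
  obtain ⟨K, hK, hjK⟩ := hj
  set B : Set X := Metric.closedBall 0 1
  have hBconv : Convex ℝ B := convex_closedBall 0 1
  let ι := NormedSpace.inclusionInDoubleDualWeak ℂ Y
  refine ⟨closure (toWeakSpace ℂ Y '' (T '' B)),
    NormedSpace.isCompact_closure_of_isBounded ℂ Y _ ?_ ?_, subset_closure⟩
  · rw [preimage_image_eq _ (toWeakSpace ℂ Y).injective]
    exact T.lipschitz.isBounded_image Metric.isBounded_closedBall
  intro φ hφ
  rw [image_image, image_image, mem_closure_iff_ultrafilter] at hφ
  obtain ⟨V, hV, hVφ⟩ := hφ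
  let U := Ultrafilter.ofComapInfPrincipal hV
  have hBU : B ∈ (U : Filter X) := Ultrafilter.ofComapInfPrincipal_mem hV
  have hUφ : Tendsto (fun x => ι (toWeakSpace ℂ Y (T x))) U (𝓝 φ) := by
    rw [← Ultrafilter.ofComapInfPrincipal_eq_of_map hV] at hVφ
    exact hVφ
  obtain ⟨w, -, hw⟩ := hK.ultrafilter_le_nhds (U.map fun x => toWeakSpace ℂ Z (j x)) <| by
    rw [le_principal_iff]
    change _ ∈ (U : Filter X)
    filter_upwards [hBU] with x hx using hjK (mem_image_of_mem _ (mem_image_of_mem _ hx))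
  obtain ⟨z, rfl⟩ := (toWeakSpace ℂ Z).surjective w
  have hneBot {A : Set X} (hA : Convex ℝ A) (hAU : A ∈ (U : Filter X)) :
      (comap j (𝓝 z) ⊓ 𝓟 A).NeBot :=
    hA.neBot_comap_nhds_inf_principal (j : X →ₗ[ℂ] Z) hAU hw
  have hB_neBot := hneBot hBconv hBU
  obtain ⟨y, hy⟩ := exists_tendsto_of_norm_le_add (T : X →ₗ[ℂ] Y) (j : X →ₗ[ℂ] Z) h
    (l := comap j (𝓝 z) ⊓ 𝓟 B) (mem_inf_of_right (mem_principal_self B))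
    (tendsto_comap.mono_left inf_le_left)
  refine ⟨toWeakSpace ℂ Y y, ?_⟩
  refine DFunLike.ext _ _ fun f => ?_
  change f y = φ f
  have hUf : Tendsto (fun x => f (T x)) U (𝓝 (φ f)) :=
    ((WeakDual.eval_continuous f).tendsto φ).comp hUφ
  refine eq_of_forall_dist_le fun δ hδ => ?_
  let A : Set X := B ∩ (fun x => f (T x)) ⁻¹' Metric.closedBall (φ f) δ
  have hA : Convex ℝ A := hBconv.inter <|
    (convex_closedBall (φ f) δ).linear_preimage ((f.comp T).restrictScalars ℝ).toLinearMap
  have hAU : A ∈ (U : Filter X) := inter_mem hBU (hUf (Metric.closedBall_mem_nhds _ hδ))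
  have hA_neBot := hneBot hA hAU
  have hyA : Tendsto T (comap j (𝓝 z) ⊓ 𝓟 A) (𝓝 y) :=
    hy.mono_left (inf_le_inf_left _ (principal_mono.2 inter_subset_left))
  exact Metric.isClosed_closedBall.mem_of_tendsto ((f.continuous.tendsto y).comp hyA)
    (mem_inf_of_right fun x hx => hx.2)

end
end

section
/- There exists an Orlicz function Ψ such that lim_{x→∞} Ψ(5x)/Ψ(x) = +∞ but liminf_{x→∞} Ψ(2x)/Ψ(x) < +∞. -/
open MeasureTheory Filter Set Topology ENNReal NNReal

noncomputable section

/-- The weights `(k + 1)! * 4 ^ k`, which outgrow the sum of all earlier weights by an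
unbounded factor. -/
def kinkWeight (k : ℕ) : ℝ := (k + 1).factorial * 4 ^ k

lemma kinkWeight_nonneg (k : ℕ) : 0 ≤ kinkWeight k := by
  unfold kinkWeight; positivity

lemma kinkWeight_succ (k : ℕ) : kinkWeight (k + 1) = 4 * (k + 2) * kinkWeight k := by
  simp only [kinkWeight, Nat.factorial_succ (k + 1)]
  push_cast
  ring

lemma pow_le_kinkWeight (k : ℕ) : (4 : ℝ) ^ k ≤ kinkWeight k := by
  have h : (1 : ℝ) ≤ (k + 1).factorial := by exact_mod_cast Nat.factorial_pos (k + 1)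
  exact le_mul_of_one_le_left (by positivity) h

lemma sum_kinkWeight_le (n : ℕ) : ∑ k ∈ Finset.range (n + 1), kinkWeight k ≤ 2 * kinkWeight n := by
  induction n with
  | zero => have := kinkWeight_nonneg 0; simp; linarith
  | succ n ih =>
    rw [Finset.sum_range_succ, kinkWeight_succ]
    nlinarith [kinkWeight_nonneg n, mul_nonneg (Nat.cast_nonneg (α := ℝ) n) (kinkWeight_nonneg n)]

/-- A piecewise linear convex function with a kink at each power of `4`. -/
def kinked (x : ℝ) : ℝ := ∑' k : ℕ, kinkWeight k * max (x - 4 ^ k) 0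

lemma kinked_eq_sum {x : ℝ} {N : ℕ} (hx : x ≤ 4 ^ N) :
    kinked x = ∑ k ∈ Finset.range N, kinkWeight k * max (x - 4 ^ k) 0 := by
  refine tsum_eq_sum fun k hk => ?_
  have hNk : N ≤ k := by simpa using hk
  have h : (4 : ℝ) ^ N ≤ 4 ^ k := pow_le_pow_right₀ (by norm_num) hNk
  rw [max_eq_right (by linarith), mul_zero]

lemma exists_le_four_pow (x : ℝ) : ∃ N : ℕ, x ≤ 4 ^ N :=
  (pow_unbounded_of_one_lt x (by norm_num : (1 : ℝ) < 4)).imp fun _ h => h.le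

lemma kinked_nonneg (x : ℝ) : 0 ≤ kinked x :=
  tsum_nonneg fun k => mul_nonneg (kinkWeight_nonneg k) (le_max_right _ _)

lemma kinked_mono : Monotone kinked := by
  intro x y hxy
  obtain ⟨N, hN⟩ := exists_le_four_pow y
  rw [kinked_eq_sum hN, kinked_eq_sum (hxy.trans hN)]
  gcongr with k
  exact kinkWeight_nonneg k

lemma kinked_convexOn (s : Set ℝ) (hs : Convex ℝ s) : ConvexOn ℝ s kinked := by
  refine ⟨hs, fun x _ y _ a b ha hb hab => ?_⟩
  obtain ⟨N, hN⟩ := exists_le_four_pow (max x y)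
  have hx := (le_max_left x y).trans hN
  have hy := (le_max_right x y).trans hN
  have hxy : a • x + b • y ≤ 4 ^ N := (convex_Iic (𝕜 := ℝ) ((4 : ℝ) ^ N)) hx hy ha hb hab
  rw [kinked_eq_sum hx, kinked_eq_sum hy, kinked_eq_sum hxy]
  simp only [smul_eq_mul, Finset.mul_sum, ← Finset.sum_add_distrib]
  refine Finset.sum_le_sum fun k _ => ?_
  have h : max (a * x + b * y - 4 ^ k) 0 ≤ a * max (x - 4 ^ k) 0 + b * max (y - 4 ^ k) 0 := by
    refine max_le ?_ (by positivity)
    have h4 : a * x + b * y - 4 ^ k = a * (x - 4 ^ k) + b * (y - 4 ^ k) := by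
      linear_combination (4 : ℝ) ^ k * hab
    rw [h4]
    gcongr <;> exact le_max_left _ _
  calc kinkWeight k * max (a * x + b * y - 4 ^ k) 0
      ≤ kinkWeight k * (a * max (x - 4 ^ k) 0 + b * max (y - 4 ^ k) 0) :=
        mul_le_mul_of_nonneg_left h (kinkWeight_nonneg k)
    _ = _ := by ring

lemma isOrliczFunction_sq_add_kinked : IsOrliczFunction fun x => x ^ 2 + kinked x where
  map_zero := by simp [kinked_eq_sum (x := 0) (N := 0) (by norm_num)]
  nonneg x := add_nonneg (sq_nonneg x) (kinked_nonneg x)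
  mono x hx y _ hxy := add_le_add (pow_le_pow_left₀ hx hxy 2) (kinked_mono hxy)
  strictConvexOn :=
    ((even_two.strictConvexOn_pow two_ne_zero).subset (subset_univ _)
      (convex_Ici 0)).add_convexOn (kinked_convexOn _ (convex_Ici 0))
  continuousWithinAt_zero := by
    have h : (fun x : ℝ => x ^ 2 + kinked x) =ᶠ[𝓝 0] fun x => x ^ 2 := by
      filter_upwards [Iio_mem_nhds (zero_lt_one (α := ℝ))] with x hx
      simp [kinked_eq_sum (x := x) (N := 0) (by simpa using (mem_Iio.mp hx).le)]
    exact ((continuous_pow 2).continuousAt.congr h.symm).continuousWithinAt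
  tendsto_div_atTop := by
    refine tendsto_atTop_mono' atTop ?_ tendsto_id
    filter_upwards [eventually_gt_atTop 0] with x hx
    rw [id, le_div_iff₀ hx]
    nlinarith [kinked_nonneg x]

lemma kinked_le {x : ℝ} (hx : 0 ≤ x) {n : ℕ} (hn : x ≤ 4 ^ (n + 1)) :
    kinked x ≤ 2 * kinkWeight n * x := by
  rw [kinked_eq_sum hn]
  calc _ ≤ ∑ k ∈ Finset.range (n + 1), kinkWeight k * x := by
        refine Finset.sum_le_sum fun k _ => mul_le_mul_of_nonneg_left ?_ (kinkWeight_nonneg k)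
        exact max_le (sub_le_self _ (by positivity)) hx
    _ ≤ _ := by
      rw [← Finset.sum_mul]
      exact mul_le_mul_of_nonneg_right (sum_kinkWeight_le n) hx

lemma kinkWeight_mul_sub_le_kinked (k : ℕ) (x : ℝ) : kinkWeight k * (x - 4 ^ k) ≤ kinked x := by
  obtain ⟨N, hN⟩ := exists_le_four_pow x
  have hN' : x ≤ 4 ^ (max N (k + 1)) :=
    hN.trans (pow_le_pow_right₀ (by norm_num) (le_max_left _ _))
  rw [kinked_eq_sum hN']
  refine (mul_le_mul_of_nonneg_left (le_max_left _ 0) (kinkWeight_nonneg k)).trans ?_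
  refine Finset.single_le_sum (f := fun k => kinkWeight k * max (x - 4 ^ k) 0)
    (fun i _ => mul_nonneg (kinkWeight_nonneg i) (le_max_right _ _)) ?_
  exact Finset.mem_range.mpr (lt_max_of_lt_right k.lt_succ_self)

lemma mul_sq_add_kinked_le {x : ℝ} {n : ℕ} (hn : 4 ^ n ≤ x) (hn' : x ≤ 4 ^ (n + 1)) :
    (n / 2 : ℝ) * (x ^ 2 + kinked x) ≤ (5 * x) ^ 2 + kinked (5 * x) := by
  have hx : 0 < x := lt_of_lt_of_le (by positivity) hn
  have hw := kinkWeight_nonneg n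
  have hsq : x ^ 2 ≤ 4 * kinkWeight n * x := by
    rw [pow_succ] at hn'
    nlinarith [pow_le_kinkWeight n]
  have hbelow : x ^ 2 + kinked x ≤ 6 * kinkWeight n * x := by linarith [kinked_le hx.le hn']
  have habove : 4 * (n + 2) * kinkWeight n * x ≤ kinked (5 * x) := by
    refine le_trans ?_ (kinkWeight_mul_sub_le_kinked (n + 1) (5 * x))
    rw [kinkWeight_succ]
    refine mul_le_mul_of_nonneg_left ?_ (by positivity)
    rw [pow_succ]
    linarith
  calc (n / 2 : ℝ) * (x ^ 2 + kinked x) ≤ n / 2 * (6 * kinkWeight n * x) := by gcongr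
    _ ≤ 4 * (n + 2) * kinkWeight n * x := by
      nlinarith [mul_nonneg hw hx.le, mul_nonneg (Nat.cast_nonneg (α := ℝ) n) (mul_nonneg hw hx.le)]
    _ ≤ _ := by linarith [sq_nonneg (5 * x)]

lemma kinked_four_mul_pow_le (n : ℕ) : kinked (2 * (2 * 4 ^ n)) ≤ 3 * kinked (2 * 4 ^ n) := by
  have hpos : (0 : ℝ) < 4 ^ n := by positivity
  rw [kinked_eq_sum (N := n + 1) (by rw [pow_succ]; linarith),
    kinked_eq_sum (N := n + 1) (by rw [pow_succ]; linarith), Finset.mul_sum]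
  refine Finset.sum_le_sum fun k hk => ?_
  have hk' : (4 : ℝ) ^ k ≤ 4 ^ n :=
    pow_le_pow_right₀ (by norm_num) (Nat.lt_succ_iff.mp (Finset.mem_range.mp hk))
  rw [max_eq_left (by linarith), max_eq_left (by linarith)]
  nlinarith [kinkWeight_nonneg k]

lemma tendsto_sq_add_kinked_five_mul_div :
    Tendsto (fun x : ℝ => ((5 * x) ^ 2 + kinked (5 * x)) / (x ^ 2 + kinked x)) atTop atTop := by
  refine tendsto_atTop.mpr fun C => ?_
  obtain ⟨N, hN⟩ := exists_nat_ge (2 * C)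
  filter_upwards [eventually_ge_atTop ((4 : ℝ) ^ N)] with x hx
  have hx1 : 1 ≤ x := (one_le_pow₀ (by norm_num)).trans hx
  obtain ⟨n, hn, hn'⟩ := exists_nat_pow_near hx1 (by norm_num : (1 : ℝ) < 4)
  have hNn : N ≤ n := by
    have := (pow_lt_pow_iff_right₀ (by norm_num : (1 : ℝ) < 4)).mp (hx.trans_lt hn')
    omega
  have hpos : 0 < x ^ 2 + kinked x := add_pos_of_pos_of_nonneg (by positivity) (kinked_nonneg x)
  have hC : C ≤ n / 2 := by
    have : (N : ℝ) ≤ n := by exact_mod_cast hNn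
    linarith
  rw [le_div_iff₀ hpos]
  exact (mul_le_mul_of_nonneg_right hC hpos.le).trans (mul_sq_add_kinked_le hn hn'.le)

lemma frequently_sq_add_kinked_two_mul_div_le :
    ∃ᶠ x : ℝ in atTop, ((2 * x) ^ 2 + kinked (2 * x)) / (x ^ 2 + kinked x) ≤ 4 := by
  refine frequently_atTop.mpr fun a => ?_
  obtain ⟨n, hn⟩ := exists_le_four_pow a
  have hpos : (0 : ℝ) < 4 ^ n := by positivity
  refine ⟨2 * 4 ^ n, by linarith, ?_⟩
  have hk := kinked_nonneg (2 * 4 ^ n)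
  rw [div_le_iff₀ (by positivity)]
  linarith [kinked_four_mul_pow_le n]

/-- There is an Orlicz function `Ψ` with `Ψ(5x)/Ψ(x) → ∞` but
`liminf_{x→∞} Ψ(2x)/Ψ(x) < ∞`. -/
theorem statement6 :
    ∃ Ψ : ℝ → ℝ, IsOrliczFunction Ψ ∧
      Tendsto (fun x => Ψ (5 * x) / Ψ x) atTop atTop ∧
      Filter.liminf (fun x : ℝ => ENNReal.ofReal (Ψ (2 * x) / Ψ x)) atTop < ⊤ := by
  refine ⟨fun x => x ^ 2 + kinked x, isOrliczFunction_sq_add_kinked,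
    tendsto_sq_add_kinked_five_mul_div, ?_⟩
  refine lt_of_le_of_lt (b := ENNReal.ofReal 4) ?_ ENNReal.ofReal_lt_top
  exact liminf_le_of_frequently_le'
    (frequently_sq_add_kinked_two_mul_div_le.mono fun _ h => ENNReal.ofReal_le_ofReal h)

end
end

section
/- Let Ψ be an Orlicz function satisfying the Δ⁰ condition. Then the complementary Orlicz function Φ of Ψ satisfies the Δ₂ condition, i.e., there are K > 0 and x₀ > 0 with Φ(2x) ≤ K Φ(x) for all x ≥ x₀. -/
open MeasureTheory Filter Set Topology ENNReal NNReal

noncomputable section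

/-- The set whose supremum defines the complementary function is bounded above. -/
theorem IsOrliczFunction.bddAbove_image {Ψ : ℝ → ℝ} (hΨ : IsOrliczFunction Ψ) {x : ℝ}
    (hx : 0 ≤ x) : BddAbove ((fun y => x * y - Ψ y) '' Set.Ici (0 : ℝ)) := by
  obtain ⟨Y, hY0, hY⟩ := ((hΨ.tendsto_div_atTop.eventually_ge_atTop x).and
    (eventually_gt_atTop 0)).exists_forall_of_atTop.imp fun Y h => And.intro (h Y le_rfl).2 h
  refine ⟨x * Y, ?_⟩
  rintro _ ⟨y, -, rfl⟩
  rcases le_total y Y with h | h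
  · have := mul_le_mul_of_nonneg_left h hx
    have := hΨ.nonneg y
    dsimp only
    linarith
  · obtain ⟨h1, h2⟩ := hY y h
    rw [le_div_iff₀ h2] at h1
    have := mul_nonneg hx hY0.le
    dsimp only
    linarith

/-- Young's inequality for an Orlicz function and its complementary function. -/
theorem IsOrliczFunction.mul_sub_le_complementaryOrlicz {Ψ : ℝ → ℝ} (hΨ : IsOrliczFunction Ψ)
    {x y : ℝ} (hx : 0 ≤ x) (hy : 0 ≤ y) : x * y - Ψ y ≤ complementaryOrlicz Ψ x :=
  le_csSup (hΨ.bddAbove_image hx) ⟨y, hy, rfl⟩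

/-- If `Ψ` satisfies the `Δ⁰` condition, then its complementary function satisfies `Δ₂`. -/
theorem statement7 {Ψ : ℝ → ℝ} (hΨ : IsOrliczFunction Ψ) (hΔ : Delta0 Ψ) :
    ∃ K > 0, ∃ x₀ > 0, ∀ x ≥ x₀,
      complementaryOrlicz Ψ (2 * x) ≤ K * complementaryOrlicz Ψ x := by
  obtain ⟨β, hβ, hlim⟩ := hΔ
  have hβ0 : 0 < β := by linarith
  obtain ⟨A, hA0, hA⟩ := ((hlim.eventually_ge_atTop (2 * β)).and
    (eventually_gt_atTop 0)).exists_forall_of_atTop.imp fun A h => And.intro (h A le_rfl).2 h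
  have hgrowth : ∀ z ≥ A, 2 * β * Ψ z ≤ Ψ (β * z) := by
    intro z hz
    rcases (hΨ.nonneg z).eq_or_lt with h | h
    · rw [← h, mul_zero]
      exact hΨ.nonneg _
    · exact (le_div_iff₀ h).1 (hA z hz).1
  refine ⟨4 * β, by positivity, 2 * Ψ A / A + 1, ?_, fun x hx => ?_⟩
  · have := div_nonneg (mul_nonneg zero_le_two (hΨ.nonneg A)) hA0.le
    linarith
  have hxA : 2 * Ψ A ≤ x * A := by
    rw [← div_le_iff₀ hA0]
    linarith
  have hx0 : 0 ≤ x := nonneg_of_mul_nonneg_left (by linarith [hΨ.nonneg A]) hA0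
  have hΦ0 : 0 ≤ complementaryOrlicz Ψ x := by
    simpa [hΨ.map_zero] using hΨ.mul_sub_le_complementaryOrlicz hx0 le_rfl
  refine csSup_le (nonempty_Ici.image _) ?_
  rintro _ ⟨y, -, rfl⟩
  dsimp only
  rcases le_total y (β * A) with h | h
  · have hΦA := hΨ.mul_sub_le_complementaryOrlicz hx0 hA0.le
    calc 2 * x * y - Ψ y ≤ 2 * x * y := sub_le_self _ (hΨ.nonneg y)
      _ ≤ 2 * x * (β * A) := by gcongr
      _ = 4 * β * (x * A / 2) := by ring
      _ ≤ 4 * β * complementaryOrlicz Ψ x := by gcongr; linarith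
  · obtain ⟨z, rfl⟩ : ∃ z, y = β * z := ⟨y / β, by field_simp⟩
    have hz : A ≤ z := le_of_mul_le_mul_left h hβ0
    calc 2 * x * (β * z) - Ψ (β * z) ≤ 2 * β * (x * z - Ψ z) := by linarith [hgrowth z hz]
      _ ≤ 2 * β * complementaryOrlicz Ψ x := by
        gcongr
        exact hΨ.mul_sub_le_complementaryOrlicz hx0 (hA0.le.trans hz)
      _ ≤ 4 * β * complementaryOrlicz Ψ x := by gcongr; norm_num

end
end
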